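/- Gaussian Dirichlet theorem for simultaneous congruences: given pairwise coprime nonzero ideals 𝔪₁, …, 𝔪_J of ℤ[i] and elements α₁, …, α_J ∈ ℤ[i] with each α_j coprime to 𝔪_j, there exist infinitely many prime elements x ∈ ℤ[i] with x ≡ α_j (mod 𝔪_j) for all j. -/

import Mathlib

local notation "ℤ[i]" => GaussianInt

/-- The imaginary unit `i` in `ℤ[i]`. -/
def gi : ℤ[i] := Zsqrtd.sqrtd

/-- `α` is primary if `α ≡ 1 (mod 2(1+i))`. -/
def IsPrimary (α : ℤ[i]) : Prop := 2 * (1 + gi) ∣ α - 1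

set_option autoImplicit false

namespace GD

section part1


/-- The norm as a natural number. -/
def nn (z : ℤ[i]) : ℕ := (Zsqrtd.norm z).natAbs

lemma nn_eq (z : ℤ[i]) : ((nn z : ℕ) : ℤ) = z.re * z.re + z.im * z.im := by
  unfold nn
  rw [GaussianInt.abs_natCast_norm, Zsqrtd.norm_def]; ring

lemma nn_mul (z w : ℤ[i]) : nn (z * w) = nn z * nn w := by
  simp [nn, Zsqrtd.norm_mul, Int.natAbs_mul]

lemma nn_one : nn 1 = 1 := by simp [nn]

lemma nn_pow (z : ℤ[i]) (k : ℕ) : nn (z ^ k) = nn z ^ k := by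
  induction k with
  | zero => simp [nn_one]
  | succ k ih => rw [pow_succ, nn_mul, ih, pow_succ]

lemma nn_eq_zero {z : ℤ[i]} : nn z = 0 ↔ z = 0 := by
  simp [nn]

lemma nn_zero : nn 0 = 0 := nn_eq_zero.2 rfl

lemma nn_neg (z : ℤ[i]) : nn (-z) = nn z := by simp [nn]

lemma nn_pos {z : ℤ[i]} (h : z ≠ 0) : 0 < nn z := Nat.pos_of_ne_zero (mt nn_eq_zero.1 h)

lemma nn_eq_one {z : ℤ[i]} : nn z = 1 ↔ IsUnit z := Zsqrtd.norm_eq_one_iff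

lemma nn_le_of_dvd {z w : ℤ[i]} (h : z ∣ w) (hw : w ≠ 0) : nn z ≤ nn w := by
  obtain ⟨c, rfl⟩ := h
  rw [nn_mul]
  exact Nat.le_mul_of_pos_right _ (nn_pos (right_ne_zero_of_mul hw))

lemma finite_nn_le (n : ℕ) : {z : ℤ[i] | nn z ≤ n}.Finite := by
  have h : ((Set.Icc (-(n:ℤ)) n) ×ˢ (Set.Icc (-(n:ℤ)) n)).Finite :=
    (Set.finite_Icc _ _).prod (Set.finite_Icc _ _)
  refine Set.Finite.of_finite_image (f := fun z : ℤ[i] => (z.re, z.im)) (h.subset ?_) ?_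
  · rintro _ ⟨z, hz, rfl⟩
    have h1 := nn_eq z
    have hz' : ((nn z : ℕ) : ℤ) ≤ n := by exact_mod_cast hz
    simp only [Set.mem_prod, Set.mem_Icc]
    refine ⟨⟨?_, ?_⟩, ⟨?_, ?_⟩⟩ <;> nlinarith [mul_self_nonneg z.re, mul_self_nonneg z.im]
  · intro a _ b _ hab
    simp only [Prod.mk.injEq] at hab
    exact Zsqrtd.ext hab.1 hab.2

/-- Elements of norm exactly `n`. -/
noncomputable def S (n : ℕ) : Finset ℤ[i] :=
  ((finite_nn_le n).subset (t := {z : ℤ[i] | nn z = n}) (fun _ h => le_of_eq h)).toFinset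

lemma mem_S {n : ℕ} {z : ℤ[i]} : z ∈ S n ↔ nn z = n := by simp [S]

lemma summable_nn {σ : ℝ} (hσ : 1 < σ) : Summable fun z : ℤ[i] => (nn z : ℝ) ^ (-σ) := by
  have h := EisensteinSeries.summable_one_div_norm_rpow (k := 2 * σ) (by linarith)
  have hinj : Function.Injective (fun z : ℤ[i] => (![z.re, z.im] : Fin 2 → ℤ)) := by
    intro a b hab
    have h0 := congrFun hab 0
    have h1 := congrFun hab 1
    exact Zsqrtd.ext h0 h1
  have h2 := h.comp_injective hinj
  refine Summable.of_nonneg_of_le (fun z => by positivity) (fun z => ?_) h2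
  simp only [Function.comp]
  rcases eq_or_ne z 0 with rfl | hz
  · rw [nn_zero, Nat.cast_zero, Real.zero_rpow (by linarith)]; positivity
  set v : Fin 2 → ℤ := ![z.re, z.im] with hv
  have hvpos : 0 < ‖v‖ := by
    rw [norm_pos_iff]
    intro h0
    apply hz
    exact hinj (by simpa [hv] using h0)
  have hle : ‖v‖ ^ 2 ≤ (nn z : ℝ) := by
    have hn : (nn z : ℝ) = (z.re:ℝ)^2 + (z.im:ℝ)^2 := by
      have := nn_eq z
      have h3 : ((nn z : ℤ) : ℝ) = ((z.re * z.re + z.im * z.im : ℤ) : ℝ) := by rw [this]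
      push_cast at h3
      rw [h3]; ring
    have h4 : ‖v‖ ≤ Real.sqrt (nn z) := by
      rw [pi_norm_le_iff_of_nonneg (Real.sqrt_nonneg _)]
      intro i
      apply Real.le_sqrt_of_sq_le
      rw [Int.norm_eq_abs, sq_abs, hn]
      fin_cases i <;> simp [hv] <;> positivity
    calc ‖v‖ ^ 2 ≤ (Real.sqrt (nn z)) ^ 2 := by gcongr
      _ = _ := Real.sq_sqrt (by positivity)
  have : ‖v‖ ^ (-(2 * σ)) = (‖v‖ ^ 2) ^ (-σ) := by
    rw [← Real.rpow_natCast, ← Real.rpow_mul hvpos.le]; congr 1; push_cast; ring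
  rw [this]
  exact Real.rpow_le_rpow_of_nonpos (by positivity) hle (by linarith)

/-- The Dirichlet term. -/
noncomputable def T (s : ℂ) (z : ℤ[i]) : ℂ := (nn z : ℂ) ^ (-s)

lemma norm_T {s : ℂ} (hs : 0 < s.re) (z : ℤ[i]) : ‖T s z‖ = (nn z : ℝ) ^ (-s.re) := by
  unfold T
  rcases eq_or_ne z 0 with rfl | hz
  · have : s ≠ 0 := by rintro rfl; simp at hs
    rw [nn_zero, Nat.cast_zero, Complex.zero_cpow (by simpa using this), Nat.cast_zero,
      Real.zero_rpow (by linarith)]; simp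
  · rw [Complex.norm_natCast_cpow_of_pos (nn_pos hz)]; simp

lemma summable_mul_T {f : ℤ[i] → ℂ} {C : ℝ} (hf : ∀ z, ‖f z‖ ≤ C) {s : ℂ} (hs : 1 < s.re) :
    Summable fun z => f z * T s z := by
  refine Summable.of_norm_bounded (g := fun z => C * (nn z : ℝ) ^ (-s.re))
    ((summable_nn hs).mul_left _) (fun z => ?_)
  rw [norm_mul, norm_T (by linarith)]
  gcongr
  exact hf z

/-- Push a function on `ℤ[i]` to an arithmetic function. -/
noncomputable def fold (f : ℤ[i] → ℂ) (n : ℕ) : ℂ := ∑ z ∈ S n, f z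

lemma fold_term (f : ℤ[i] → ℂ) {s : ℂ} (hs : s ≠ 0) (n : ℕ) :
    LSeries.term (fold f) s n = ∑ z ∈ S n, f z * T s z := by
  rw [LSeries.term_def]
  split_ifs with h
  · subst h
    symm
    apply Finset.sum_eq_zero
    intro z hz
    rw [mem_S] at hz
    simp [T, hz, hs]
  · rw [fold, Finset.sum_div]
    apply Finset.sum_congr rfl
    intro z hz
    rw [mem_S] at hz
    rw [T, hz, Complex.cpow_neg, div_eq_mul_inv]

lemma hasSum_fold {f : ℤ[i] → ℂ} {s : ℂ} (hs : s ≠ 0) (h : Summable fun z => f z * T s z) :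
    LSeriesHasSum (fold f) s (∑' z, f z * T s z) := by
  have h1 := h.hasSum
  have h2 := (Equiv.sigmaFiberEquiv nn).hasSum_iff.2 h1
  have h3 := h2.sigma (g := fun n => ∑ z ∈ S n, f z * T s z) (fun n => by
    have : Fintype {z // nn z = n} := Fintype.subtype (S n) (fun z => mem_S)
    have := hasSum_fintype (fun c : {z // nn z = n} => f c * T s c)
    convert! this using 1
    exact (Finset.sum_subtype (S n) (fun z => mem_S) (fun z => f z * T s z)))
  unfold LSeriesHasSum
  convert h3 using 1
  funext n
  exact fold_term f hs n

lemma LSeries_fold {f : ℤ[i] → ℂ} {s : ℂ} (hs : s ≠ 0) (h : Summable fun z => f z * T s z) :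
    LSeries (fold f) s = ∑' z, f z * T s z :=
  (hasSum_fold hs h).LSeries_eq

lemma abscissa_fold {f : ℤ[i] → ℂ} {C : ℝ} (hf : ∀ z, ‖f z‖ ≤ C) :
    LSeries.abscissaOfAbsConv (fold f) ≤ 1 := by
  apply LSeries.abscissaOfAbsConv_le_of_forall_lt_LSeriesSummable
  intro y hy
  have hy' : (1:ℝ) < y := by exact_mod_cast hy
  exact (hasSum_fold (s := (y:ℂ)) (by
    intro h
    have : y = 0 := by exact_mod_cast h
    linarith) (summable_mul_T hf (by simpa using hy'))).LSeriesSummable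

end part1

section part2

lemma hasDerivAt_rc (s : ℂ) {x : ℝ} (hx : 0 < x) :
    HasDerivAt (fun t : ℝ => (t : ℂ) ^ (-s)) (-s * (x : ℂ) ^ (-s - 1)) x := by
  have h := (hasDerivAt_id (x : ℂ)).cpow_const (c := -s) (Or.inl (by simpa using hx))
  simpa using h.comp_ofReal

lemma diff1 (s : ℂ) (hs : 0 < s.re) {x y : ℝ} (hx : 0 < x) (hxy : x ≤ y) :
    ‖(y : ℂ) ^ (-s) - (x : ℂ) ^ (-s)‖ ≤ ‖s‖ * x ^ (-s.re - 1) * (y - x) := by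
  have := Convex.norm_image_sub_le_of_norm_hasDerivWithin_le
    (f := fun t : ℝ => (t : ℂ) ^ (-s)) (f' := fun t : ℝ => -s * (t : ℂ) ^ (-s - 1))
    (s := Set.Icc x y) (x := x) (y := y) (C := ‖s‖ * x ^ (-s.re - 1))
    (fun t ht => (hasDerivAt_rc s (hx.trans_le ht.1)).hasDerivWithinAt)
    (fun t ht => by
      rw [norm_mul, norm_neg, Complex.norm_cpow_eq_rpow_re_of_pos (hx.trans_le ht.1)]
      gcongr
      simp only [Complex.sub_re, Complex.neg_re, Complex.one_re]
      exact Real.rpow_le_rpow_of_nonpos hx ht.1 (by linarith))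
    (convex_Icc x y) ⟨le_rfl, hxy⟩ ⟨hxy, le_rfl⟩
  rwa [Real.norm_of_nonneg (by linarith)] at this

lemma diff2 (s : ℂ) (hs : 0 < s.re) {A B : ℝ} (hB : 0 ≤ B) (hAB : B < A) :
    ‖((A + B : ℝ) : ℂ) ^ (-s) + ((A - B : ℝ) : ℂ) ^ (-s) - 2 * (A : ℂ) ^ (-s)‖ ≤
      ‖s‖ * ‖s + 1‖ * (A - B) ^ (-s.re - 2) * (2 * B ^ 2) := by
  have := Convex.norm_image_sub_le_of_norm_hasDerivWithin_le
    (f := fun b : ℝ => ((A + b : ℝ) : ℂ) ^ (-s) + ((A - b : ℝ) : ℂ) ^ (-s))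
    (f' := fun b : ℝ => -s * ((A + b : ℝ) : ℂ) ^ (-s - 1) - (-s * ((A - b : ℝ) : ℂ) ^ (-s - 1)))
    (s := Set.Icc 0 B) (x := 0) (y := B)
    (C := ‖s‖ * (‖s + 1‖ * (A - B) ^ (-s.re - 2) * (2 * B)))
    (fun b hb => by
      have h1 := (hasDerivAt_rc s (x := A + b) (by linarith [hb.1, hb.2])).comp_const_add A b
      have h2 := (hasDerivAt_rc s (x := A - b) (by linarith [hb.1, hb.2])).comp_const_sub A b
      have h3 := (h1.add h2).hasDerivWithinAt (s := Set.Icc 0 B)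
      rw [← sub_eq_add_neg] at h3
      exact h3)
    (fun b hb => by
      rw [← mul_sub, norm_mul, norm_neg]
      gcongr
      have := diff1 (s + 1) (by simp; linarith) (x := A - b) (y := A + b)
        (by linarith [hb.2]) (by linarith [hb.1])
      rw [show -(s + 1) = -s - 1 by ring] at this
      refine this.trans ?_
      have h4 : (A - b) ^ (-(s + 1).re - 1) ≤ (A - B) ^ (-s.re - 2) := by
        rw [show -(s + 1).re - 1 = -s.re - 2 by simp; ring]
        exact Real.rpow_le_rpow_of_nonpos (by linarith) (by linarith [hb.2]) (by linarith)
      have : 0 ≤ (A - b) ^ (-(s + 1).re - 1) := Real.rpow_nonneg (by linarith [hb.2]) _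
      gcongr
      · linarith [hb.1]
      · linarith [hb.2])
    (convex_Icc 0 B) ⟨le_rfl, hB⟩ ⟨hB, le_rfl⟩
  simp only [add_zero, sub_zero] at this
  rw [Real.norm_of_nonneg hB] at this
  rw [two_mul]
  refine this.trans (le_of_eq ?_)
  ring

/-- Second difference term. -/
noncomputable def U (μ α : ℤ[i]) (s : ℂ) (z : ℤ[i]) : ℂ :=
  T s (μ * z + α) + T s (μ * z - α) - 2 * T s (μ * z)

lemma norm_T_le_one {s : ℂ} (hs : 0 < s.re) (z : ℤ[i]) : ‖T s z‖ ≤ 1 := by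
  rw [norm_T hs]
  rcases Nat.eq_zero_or_pos (nn z) with h | h
  · rw [h, Nat.cast_zero, Real.zero_rpow (by linarith)]; norm_num
  · exact Real.rpow_le_one_of_one_le_of_nonpos (by exact_mod_cast h) (by linarith)

lemma norm_U_le_four (μ α : ℤ[i]) {s : ℂ} (hs : 0 < s.re) (z : ℤ[i]) : ‖U μ α s z‖ ≤ 4 := by
  unfold U
  have h1 := norm_T_le_one hs (μ * z + α)
  have h2 := norm_T_le_one hs (μ * z - α)
  have h3 := norm_T_le_one hs (μ * z)
  calc _ ≤ ‖T s (μ * z + α)‖ + ‖T s (μ * z - α)‖ + ‖2 * T s (μ * z)‖ :=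
        (norm_sub_le _ _).trans (by gcongr; exact norm_add_le _ _)
    _ ≤ 1 + 1 + 2 * 1 := by
        rw [norm_mul]; simp only [Complex.norm_ofNat]; gcongr
    _ = 4 := by norm_num

lemma norm_U_bound (μ α : ℤ[i]) {s : ℂ} (hs : 0 < s.re) (z : ℤ[i])
    (h1 : 1 ≤ nn (μ * z)) (h16 : 16 * nn α ≤ nn (μ * z)) :
    ‖U μ α s z‖ ≤ (‖s‖ * ‖s + 1‖ * 2 ^ (s.re + 2) * 8 + 2 * ‖s‖) * (nn α) *
      (nn (μ * z) : ℝ) ^ (-s.re - 1) := by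
  unfold U
  generalize μ * z = w at *
  obtain ⟨n, hn⟩ : ∃ n : ℝ, n = (nn w : ℝ) := ⟨_, rfl⟩
  obtain ⟨a, ha⟩ : ∃ a : ℝ, a = (nn α : ℝ) := ⟨_, rfl⟩
  rw [← hn, ← ha]
  obtain ⟨b, hb⟩ : ∃ b : ℤ, b = 2 * (w.re * α.re + w.im * α.im) := ⟨_, rfl⟩
  have e1 : (nn (w + α) : ℝ) = n + a + b := by
    have : ((nn (w + α) : ℕ) : ℤ) = nn w + nn α + b := by
      rw [nn_eq, nn_eq, nn_eq, hb]; simp; ring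
    rw [hn, ha]
    have h := congrArg (Int.cast : ℤ → ℝ) this
    push_cast at h
    exact h
  have e2 : (nn (w - α) : ℝ) = n + a - b := by
    have : ((nn (w - α) : ℕ) : ℤ) = nn w + nn α - b := by
      rw [nn_eq, nn_eq, nn_eq, hb]; simp; ring
    rw [hn, ha]
    have h := congrArg (Int.cast : ℤ → ℝ) this
    push_cast at h
    exact h
  have e3 : (b : ℝ) ^ 2 ≤ 4 * n * a := by
    have : b ^ 2 ≤ 4 * (nn w : ℤ) * nn α := by
      rw [nn_eq, nn_eq, hb]; nlinarith [sq_nonneg (w.re * α.im - w.im * α.re)]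
    rw [hn, ha]
    have h : ((b ^ 2 : ℤ) : ℝ) ≤ ((4 * (nn w : ℤ) * nn α : ℤ) : ℝ) := Int.cast_le.2 this
    push_cast at h
    exact h
  have hn1 : 1 ≤ n := by rw [hn]; exact_mod_cast h1
  have hna : 16 * a ≤ n := by rw [hn, ha]; exact_mod_cast h16
  have ha0 : 0 ≤ a := by rw [ha]; positivity
  set B : ℝ := |(b : ℝ)| with hBdef
  have hB0 : 0 ≤ B := abs_nonneg _
  have hB2 : B ^ 2 ≤ 4 * n * a := by rw [hBdef, sq_abs]; exact e3
  have hBn : B ≤ n / 2 := by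
    apply le_of_sq_le_sq _ (by linarith)
    nlinarith
  have hT : ∀ v, T s v = (((nn v : ℝ)) : ℂ) ^ (-s) := fun v => by simp [T]
  have hsum : T s (w + α) + T s (w - α) =
      ((n + a + B : ℝ) : ℂ) ^ (-s) + ((n + a - B : ℝ) : ℂ) ^ (-s) := by
    rw [hT, hT, e1, e2, hBdef]
    rcases abs_cases (b : ℝ) with ⟨h, _⟩ | ⟨h, _⟩
    · rw [h]
    · rw [h, add_comm, sub_neg_eq_add, ← sub_eq_add_neg]
  rw [hsum, hT w, ← hn]
  have d2 := diff2 s hs (A := n + a) (B := B) hB0 (by linarith)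
  have d1 := diff1 s hs (x := n) (y := n + a) (by linarith) (by linarith)
  have hx : (n + a - B) ^ (-s.re - 2) ≤ 2 ^ (s.re + 2) * n ^ (-s.re - 1) * n⁻¹ := by
    calc (n + a - B) ^ (-s.re - 2) ≤ (n / 2) ^ (-s.re - 2) :=
          Real.rpow_le_rpow_of_nonpos (by linarith) (by linarith) (by linarith)
      _ = _ := by
          rw [Real.div_rpow (by linarith) (by norm_num), div_eq_mul_inv,
            ← Real.rpow_neg (by norm_num), mul_assoc, mul_comm]
          congr 1
          · congr 1; ring
          · rw [← Real.rpow_neg_one, ← Real.rpow_add (by linarith)]; congr 1; ring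
  calc _ = ‖(((n + a + B : ℝ) : ℂ) ^ (-s) + ((n + a - B : ℝ) : ℂ) ^ (-s)
          - 2 * ((n + a : ℝ) : ℂ) ^ (-s)) + 2 * (((n + a : ℝ) : ℂ) ^ (-s) - (n : ℂ) ^ (-s))‖ := by
        congr 1; ring
    _ ≤ ‖s‖ * ‖s + 1‖ * (n + a - B) ^ (-s.re - 2) * (2 * B ^ 2) +
        2 * (‖s‖ * n ^ (-s.re - 1) * (n + a - n)) := by
        refine (norm_add_le _ _).trans (add_le_add d2 ?_)
        rw [norm_mul, Complex.norm_ofNat]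
        gcongr
    _ ≤ ‖s‖ * ‖s + 1‖ * (2 ^ (s.re + 2) * n ^ (-s.re - 1) * n⁻¹) * (2 * (4 * n * a)) +
        2 * (‖s‖ * n ^ (-s.re - 1) * (n + a - n)) := by
        gcongr
    _ = _ := by
        field_simp
        ring

lemma differentiableOn_T (z : ℤ[i]) : DifferentiableOn ℂ (fun s => T s z) {s | 0 < s.re} := by
  intro s hs
  apply DifferentiableAt.differentiableWithinAt
  unfold T
  refine DifferentiableAt.const_cpow (by fun_prop) (Or.inr ?_)
  intro h
  simp at h
  subst h
  simp at hs

lemma summable_comp_mul {μ : ℤ[i]} (hμ : μ ≠ 0) {σ : ℝ} (hσ : 1 < σ) :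
    Summable fun z : ℤ[i] => (nn (μ * z) : ℝ) ^ (-σ) :=
  (summable_nn hσ).comp_injective (mul_right_injective₀ hμ)

lemma differentiableOn_U {μ : ℤ[i]} (hμ : μ ≠ 0) (α : ℤ[i]) :
    DifferentiableOn ℂ (fun s => ∑' z, U μ α s z) {s | 0 < s.re} := by
  classical
  have key : ∀ ε M : ℝ, 0 < ε → 0 < M →
      DifferentiableOn ℂ (fun s => ∑' z, U μ α s z) {s | ε < s.re ∧ ‖s‖ < M} := by
    intro ε M hε hM
    set F : Set ℤ[i] := {z | nn z ≤ 16 * nn α} with hF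
    have hFf : F.Finite := finite_nn_le _
    set C : ℝ := (M * (M + 1) * 2 ^ (M + 2) * 8 + 2 * M) * nn α with hC
    refine Complex.differentiableOn_tsum_of_summable_norm
      (u := fun z => (if z ∈ F then 4 else 0) + C * (nn (μ * z) : ℝ) ^ (-(ε + 1))) ?_ ?_ ?_ ?_
    · refine Summable.add ?_ ((summable_comp_mul hμ (by linarith)).mul_left _)
      refine summable_of_ne_finset_zero (s := hFf.toFinset) (fun z hz => ?_)
      rw [if_neg]
      simpa using hz
    · intro z
      unfold U
      have hsub : {s : ℂ | ε < s.re ∧ ‖s‖ < M} ⊆ {s | 0 < s.re} := fun s hs => hε.trans hs.1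
      exact (((differentiableOn_T _).add (differentiableOn_T _)).sub
        ((differentiableOn_T _).const_mul 2)).mono hsub
    · exact (isOpen_lt continuous_const Complex.continuous_re).inter
        (isOpen_lt continuous_norm continuous_const)
    · intro z s hs
      have hs0 : 0 < s.re := hε.trans hs.1
      have hC0 : 0 ≤ C := by positivity
      by_cases hz : z ∈ F
      · rw [if_pos hz]
        have := norm_U_le_four μ α hs0 z
        have h0 : 0 ≤ C * (nn (μ * z) : ℝ) ^ (-(ε + 1)) := by positivity
        linarith
      · rw [if_neg hz, zero_add]
        have hz' : 16 * nn α < nn z := by simpa [hF] using hz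
        have hz0 : z ≠ 0 := by rintro rfl; simp [nn_zero] at hz'
        have h1 : 1 ≤ nn (μ * z) := nn_pos (mul_ne_zero hμ hz0)
        have h16 : 16 * nn α ≤ nn (μ * z) := by
          rw [nn_mul]
          exact hz'.le.trans (Nat.le_mul_of_pos_left _ (nn_pos hμ))
        refine (norm_U_bound μ α hs0 z h1 h16).trans ?_
        have hsM : ‖s‖ ≤ M := hs.2.le
        have hre : s.re ≤ M := (Complex.re_le_norm s).trans hsM
        have hs1 : ‖s + 1‖ ≤ M + 1 := (norm_add_le _ _).trans (by simpa using hsM)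
        have hp : (nn (μ * z) : ℝ) ^ (-s.re - 1) ≤ (nn (μ * z) : ℝ) ^ (-(ε + 1)) :=
          Real.rpow_le_rpow_of_exponent_le (by exact_mod_cast h1) (by linarith [hs.1])
        have h2 : (2:ℝ) ^ (s.re + 2) ≤ 2 ^ (M + 2) :=
          Real.rpow_le_rpow_of_exponent_le (by norm_num) (by linarith)
        rw [hC]
        gcongr
  intro s hs
  have hs' : 0 < s.re := hs
  have hmem : s ∈ {t : ℂ | s.re / 2 < t.re ∧ ‖t‖ < ‖s‖ + 1} := ⟨by linarith, by linarith⟩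
  have hopen : IsOpen {t : ℂ | s.re / 2 < t.re ∧ ‖t‖ < ‖s‖ + 1} :=
    (isOpen_lt continuous_const Complex.continuous_re).inter
        (isOpen_lt continuous_norm continuous_const)
  exact ((key (s.re / 2) (‖s‖ + 1) (by linarith) (by positivity)).differentiableAt
    (hopen.mem_nhds hmem)).differentiableWithinAt

lemma tsum_U {μ : ℤ[i]} (hμ : μ ≠ 0) (α : ℤ[i]) {s : ℂ} (hs : 1 < s.re) :
    ∑' z, U μ α s z = 2 * ∑' z, T s (μ * z + α) - 2 * ∑' z, T s (μ * z) := by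
  have h0 : Summable (T s) := by
    simpa using summable_mul_T (f := fun _ => 1) (C := 1) (by simp) hs
  have i1 : Function.Injective (fun z : ℤ[i] => μ * z + α) :=
    (add_left_injective α).comp (mul_right_injective₀ hμ)
  have i2 : Function.Injective (fun z : ℤ[i] => μ * z - α) :=
    (sub_left_injective (b := α)).comp (mul_right_injective₀ hμ)
  have s1 : Summable fun z => T s (μ * z + α) := h0.comp_injective i1
  have s2 : Summable fun z => T s (μ * z - α) := h0.comp_injective i2
  have s3 : Summable fun z => T s (μ * z) := h0.comp_injective (mul_right_injective₀ hμ)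
  have e : ∑' z, T s (μ * z - α) = ∑' z, T s (μ * z + α) := by
    rw [← (Equiv.neg ℤ[i]).tsum_eq]
    refine tsum_congr fun z => ?_
    simp only [Equiv.neg_apply, T]
    rw [← nn_neg]
    congr 3
    ring
  unfold U
  rw [(s1.add s2).tsum_sub (s3.mul_left 2), s1.tsum_add s2, e, tsum_mul_left]
  ring

lemma finite_quot {μ : ℤ[i]} (hμ : μ ≠ 0) : Finite (ℤ[i] ⧸ Ideal.span {μ}) := by
  have hf := finite_nn_le (nn μ)
  have : Finite {z : ℤ[i] | nn z ≤ nn μ} := hf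
  refine Finite.of_surjective
    (fun z : {z : ℤ[i] | nn z ≤ nn μ} => Ideal.Quotient.mk (Ideal.span {μ}) z.1) ?_
  intro b
  obtain ⟨z, rfl⟩ := Ideal.Quotient.mk_surjective b
  refine ⟨⟨z % μ, (GaussianInt.natAbs_norm_mod_lt z hμ).le⟩, ?_⟩
  rw [Ideal.Quotient.eq, Ideal.mem_span_singleton]
  change μ ∣ z % μ - z
  exact ⟨-(z / μ), by rw [GaussianInt.mod_def]; ring⟩

/-- The analytic continuation of a lattice Dirichlet series with mean zero periodic coefficients. -/
lemma continuation {μ : ℤ[i]} (hμ : μ ≠ 0) [Fintype (ℤ[i] ⧸ Ideal.span {μ})]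
    (f : ℤ[i] ⧸ Ideal.span {μ} → ℂ) (hf : ∑ b, f b = 0) :
    ∃ L : ℂ → ℂ, DifferentiableOn ℂ L {s | 0 < s.re} ∧
      ∀ s : ℂ, 1 < s.re → L s = ∑' z, f (Ideal.Quotient.mk _ z) * T s z := by
  refine ⟨fun s => ∑ b, f b * ((1 / 2) * ∑' z, U μ b.out s z), ?_, ?_⟩
  · exact DifferentiableOn.fun_sum fun b _ =>
      ((differentiableOn_U hμ _).const_mul _).const_mul _
  intro s hs
  simp only [tsum_U hμ _ hs]
  have e1 : ∀ b : ℤ[i] ⧸ Ideal.span {μ}, f b * ((1 / 2) * (2 * ∑' z, T s (μ * z + b.out)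
      - 2 * ∑' z, T s (μ * z))) =
      f b * ∑' z, T s (μ * z + b.out) - f b * ∑' z, T s (μ * z) := by intro b; ring
  simp only [e1, Finset.sum_sub_distrib, ← Finset.sum_mul, hf, zero_mul, sub_zero]
  have hout : ∀ b : ℤ[i] ⧸ Ideal.span {μ}, Ideal.Quotient.mk (Ideal.span {μ}) b.out = b :=
    fun b => Quotient.out_eq' b
  have hmk : ∀ (b : ℤ[i] ⧸ Ideal.span {μ}) (z : ℤ[i]),
      Ideal.Quotient.mk (Ideal.span {μ}) (μ * z + b.out) = b := by
    intro b z
    rw [map_add, hout, map_mul, Ideal.Quotient.eq_zero_iff_mem.2 (Ideal.mem_span_singleton_self μ)]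
    simp
  let g : (ℤ[i] ⧸ Ideal.span {μ}) × ℤ[i] → ℤ[i] := fun p => μ * p.2 + p.1.out
  have hg : Function.Bijective g := by
    constructor
    · rintro ⟨b, z⟩ ⟨b', z'⟩ h
      have h1 : b = b' := by rw [← hmk b z, ← hmk b' z']; exact congrArg _ h
      subst h1
      have h2 : μ * z + b.out = μ * z' + b.out := h
      have h3 := mul_left_cancel₀ hμ (add_right_cancel h2)
      rw [h3]
    · intro z
      have : z - (Ideal.Quotient.mk (Ideal.span {μ}) z).out ∈ Ideal.span {μ} := by
        rw [← Ideal.Quotient.eq, hout]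
      obtain ⟨c, hc⟩ := Ideal.mem_span_singleton.1 this
      exact ⟨(Ideal.Quotient.mk (Ideal.span {μ}) z, c), by simp only [g]; rw [← hc]; ring⟩
  obtain ⟨C, hC⟩ : ∃ C, ∀ b, ‖f b‖ ≤ C := by
    obtain ⟨C, hC⟩ := (Set.finite_range (fun b => ‖f b‖)).bddAbove
    exact ⟨C, fun b => hC ⟨b, rfl⟩⟩
  have hsum := summable_mul_T (f := fun z => f (Ideal.Quotient.mk (Ideal.span {μ}) z)) (C := C)
    (fun z => hC _) hs
  rw [← (Equiv.ofBijective g hg).tsum_eq]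
  have hsum2 := (Equiv.ofBijective g hg).summable_iff.2 hsum
  refine Eq.trans ?_ hsum2.tsum_prod.symm
  rw [tsum_fintype]
  refine Finset.sum_congr rfl fun b _ => ?_
  rw [← tsum_mul_left]
  refine tsum_congr fun z => ?_
  simp only [Function.comp, Equiv.ofBijective_apply, g, hmk]

end part2

section part3

/-- Elements of norm at most `n`. -/
noncomputable def Bl (n : ℕ) : Finset ℤ[i] := (finite_nn_le n).toFinset

lemma mem_Bl {n : ℕ} {z : ℤ[i]} : z ∈ Bl n ↔ nn z ≤ n := by simp [Bl]

instance : Finite ℤ[i]ˣ := by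
  have : Finite {z : ℤ[i] | nn z ≤ 1} := finite_nn_le 1
  refine Finite.of_injective
    (fun u : ℤ[i]ˣ => (⟨u.1, (nn_eq_one.2 u.isUnit).le⟩ : {z : ℤ[i] | nn z ≤ 1})) ?_
  intro u v h
  simp only [Subtype.mk.injEq] at h
  exact Units.ext h

/-- number of units -/
noncomputable def cu : ℝ := (Nat.card ℤ[i]ˣ : ℝ)

lemma cu_pos : 0 < cu := by
  unfold cu
  exact_mod_cast Nat.card_pos

open Classical in
/-- weight -/
noncomputable def wt (d : ℤ[i]) (p : ℤ[i] × ℕ) : ℝ :=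
  if Prime p.1 ∧ p.1 ^ (p.2 + 1) = d then Real.log (nn p.1) else 0

/-- The von Mangoldt function on `ℤ[i]`. -/
noncomputable def Lam (d : ℤ[i]) : ℝ := cu⁻¹ * ∑ᶠ p : ℤ[i] × ℕ, wt d p

lemma two_le_nn {p : ℤ[i]} (hp : Prime p) : 2 ≤ nn p := by
  have h0 := nn_pos hp.ne_zero
  have h1 : nn p ≠ 1 := fun h => hp.not_isUnit (nn_eq_one.1 h)
  omega

lemma wt_nonneg (d : ℤ[i]) (p : ℤ[i] × ℕ) : 0 ≤ wt d p := by
  unfold wt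
  split_ifs
  · exact Real.log_natCast_nonneg _
  · exact le_rfl

lemma Lam_nonneg (d : ℤ[i]) : 0 ≤ Lam d :=
  mul_nonneg (inv_nonneg.2 cu_pos.le) (finsum_nonneg (wt_nonneg d))

lemma wt_support {d : ℤ[i]} {M : ℕ} (hM : nn d ≤ M) :
    Function.support (wt d) ⊆ ((Bl M ×ˢ Finset.range M : Finset (ℤ[i] × ℕ)) : Set (ℤ[i] × ℕ)) := by
  rintro ⟨p, k⟩ h
  simp only [Function.mem_support, wt] at h
  have h' : Prime p ∧ p ^ (k + 1) = d := by
    by_contra h'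
    exact h (if_neg h')
  obtain ⟨hp, rfl⟩ := h'
  have h2 := two_le_nn hp
  rw [nn_pow] at hM
  simp only [Finset.coe_product, Set.mem_prod, Finset.mem_coe, mem_Bl, Finset.mem_range]
  have h3 : nn p ≤ nn p ^ (k + 1) := Nat.le_self_pow (by omega) _
  have h4 : k + 1 < nn p ^ (k + 1) := Nat.lt_pow_self (by omega)
  omega

lemma Lam_eq {d : ℤ[i]} {M : ℕ} (hM : nn d ≤ M) :
    Lam d = cu⁻¹ * ∑ p ∈ Bl M ×ˢ Finset.range M, wt d p := by
  unfold Lam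
  rw [finsum_eq_sum_of_support_subset _ (wt_support hM)]

lemma le_Lam {p : ℤ[i]} (hp : Prime p) (k : ℕ) :
    cu⁻¹ * Real.log (nn p) ≤ Lam (p ^ (k + 1)) := by
  rw [Lam_eq le_rfl]
  have := cu_pos
  gcongr
  have h1 : wt (p ^ (k + 1)) (p, k) = Real.log (nn p) := if_pos ⟨hp, rfl⟩
  rw [← h1]
  refine Finset.single_le_sum (f := wt (p ^ (k + 1))) (fun q _ => wt_nonneg _ q) ?_
  have := wt_support (d := p ^ (k + 1)) le_rfl (a := (p, k)) (by
    rw [Function.mem_support, h1]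
    apply ne_of_gt
    apply Real.log_pos
    exact_mod_cast two_le_nn hp)
  exact_mod_cast this

lemma Lam_ne_zero {d : ℤ[i]} (h : Lam d ≠ 0) : ∃ p k, Prime p ∧ p ^ (k + 1) = d := by
  by_contra hcon
  push Not at hcon
  apply h
  unfold Lam
  have : wt d = fun _ => 0 := by
    funext p
    exact if_neg (fun hp => hcon p.1 p.2 hp.1 hp.2)
  rw [this]
  simp

open Classical in
lemma sum_mult (M : ℕ) (z : ℤ[i]) (hz : z ≠ 0) (hM : nn z ≤ M) :
    ∑ p ∈ (Bl M).filter Prime, Real.log (nn p) * (multiplicity p z : ℝ) =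
      cu * Real.log (nn z) := by
  induction z using UniqueFactorizationMonoid.induction_on_prime with
  | h₁ => exact absurd rfl hz
  | h₂ x hx =>
    rw [nn_eq_one.2 hx, Nat.cast_one, Real.log_one, mul_zero]
    apply Finset.sum_eq_zero
    intro p hp
    have hp' := (Finset.mem_filter.1 hp).2
    have : ¬ p ∣ x := fun h => hp'.not_isUnit (isUnit_of_dvd_unit h hx)
    rw [multiplicity_eq_zero.2 this]; simp
  | h₃ a q ha hq ih =>
    have hqa : q * a ≠ 0 := hz
    have h1 := ih ha ((nn_le_of_dvd (Dvd.intro_left q rfl) hqa).trans hM)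
    have hqM : nn q ≤ M := (nn_le_of_dvd (Dvd.intro a rfl) hqa).trans hM
    have e : ∀ p ∈ (Bl M).filter Prime, Real.log (nn p) * (multiplicity p (q * a) : ℝ) =
        (if Associated p q then Real.log (nn q) else 0) + Real.log (nn p) * (multiplicity p a : ℝ) := by
      intro p hp
      have hp' := (Finset.mem_filter.1 hp).2
      have hfin : FiniteMultiplicity p (q * a) := FiniteMultiplicity.of_prime_left hp' hqa
      rw [multiplicity_mul hp' hfin]
      push_cast
      rw [mul_add]
      congr 1
      split_ifs with has
      · obtain ⟨u, hu⟩ := has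
        have : nn p = nn q := by rw [← hu, nn_mul, nn_eq_one.2 u.isUnit, mul_one]
        have h2 : multiplicity p q = 1 := by
          rw [← hu, multiplicity_mul hp'
            (FiniteMultiplicity.of_prime_left hp' (by rw [hu]; exact hq.ne_zero)),
            multiplicity_self,
            multiplicity_eq_zero.2 (fun h => hp'.not_isUnit (isUnit_of_dvd_unit h u.isUnit))]
        rw [this, h2]; simp
      · have : ¬ p ∣ q := fun h => has (hp'.associated_of_dvd hq h)
        rw [multiplicity_eq_zero.2 this]; simp
    rw [Finset.sum_congr rfl e, Finset.sum_add_distrib, h1, nn_mul]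
    have hqpos : (nn q : ℝ) ≠ 0 := by exact_mod_cast (nn_pos hq.ne_zero).ne'
    have hapos : (nn a : ℝ) ≠ 0 := by exact_mod_cast (nn_pos ha).ne'
    push_cast
    rw [Real.log_mul hqpos hapos, mul_add]
    congr 1
    rw [← Finset.sum_filter, Finset.sum_const, nsmul_eq_mul]
    congr 1
    have := Fintype.ofFinite ℤ[i]ˣ
    unfold cu
    rw [Nat.card_eq_fintype_card, ← Finset.card_univ]
    norm_cast
    rw [← Finset.card_image_of_injective Finset.univ (f := fun u : ℤ[i]ˣ => q * u)]
    · congr 1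
      ext p
      simp only [Finset.mem_filter, mem_Bl, Finset.mem_image, Finset.mem_univ, true_and]
      constructor
      · rintro ⟨_, h⟩
        obtain ⟨u, hu⟩ := h.symm
        exact ⟨u, hu⟩
      · rintro ⟨u, rfl⟩
        refine ⟨⟨?_, ?_⟩, ?_⟩
        · rw [nn_mul, nn_eq_one.2 u.isUnit, mul_one]; exact hqM
        · exact (associated_mul_unit_right q u u.isUnit).prime hq
        · exact (associated_mul_unit_right q u u.isUnit).symm
    · intro u v h
      exact Units.ext (mul_left_cancel₀ hq.ne_zero h)

open Classical in
lemma sum_Lam {z : ℤ[i]} (hz : z ≠ 0) {M : ℕ} (hM : nn z = M) :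
    ∑ d ∈ (Bl M).filter (· ∣ z), Lam d = Real.log (nn z) := by
  have e : ∀ d ∈ (Bl M).filter (· ∣ z),
      Lam d = cu⁻¹ * ∑ p ∈ Bl M ×ˢ Finset.range M, wt d p :=
    fun d hd => Lam_eq (mem_Bl.1 (Finset.mem_filter.1 hd).1)
  rw [Finset.sum_congr rfl e, ← Finset.mul_sum, Finset.sum_comm]
  have key : ∑ p ∈ Bl M ×ˢ Finset.range M, ∑ d ∈ (Bl M).filter (· ∣ z), wt d p =
      ∑ p ∈ (Bl M).filter Prime, Real.log (nn p) * (multiplicity p z : ℝ) := by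
    rw [Finset.sum_product, Finset.sum_filter]
    refine Finset.sum_congr rfl fun p hp => ?_
    split_ifs with hpr
    · have e2 : ∀ k ∈ Finset.range M, ∑ d ∈ (Bl M).filter (· ∣ z), wt d (p, k) =
          if p ^ (k + 1) ∣ z then Real.log (nn p) else 0 := by
        intro k _
        simp only [wt, hpr, true_and]
        rw [Finset.sum_ite_eq]
        congr 1
        simp only [Finset.mem_filter, mem_Bl, eq_iff_iff, and_iff_right_iff_imp]
        intro h
        rw [← hM]
        exact nn_le_of_dvd h hz
      rw [Finset.sum_congr rfl e2, ← Finset.sum_filter, Finset.sum_const, nsmul_eq_mul, mul_comm]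
      congr 2
      have hfin : FiniteMultiplicity p z := FiniteMultiplicity.of_prime_left hpr hz
      have hmM : multiplicity p z ≤ M := by
        have h1 := nn_le_of_dvd (pow_multiplicity_dvd p z) hz
        rw [nn_pow, hM] at h1
        exact (Nat.lt_pow_self (two_le_nn hpr)).le.trans h1
      have : (Finset.range M).filter (fun k => p ^ (k + 1) ∣ z) = Finset.range (multiplicity p z) := by
        ext k
        simp only [Finset.mem_filter, Finset.mem_range, hfin.pow_dvd_iff_le_multiplicity]
        omega
      rw [this, Finset.card_range]
    · refine Finset.sum_eq_zero fun k _ => Finset.sum_eq_zero fun d _ => ?_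
      exact if_neg (fun h => hpr h.1)
  rw [key, sum_mult M z hz hM.le, ← mul_assoc, inv_mul_cancel₀ cu_pos.ne', one_mul]

lemma Lam_zero : Lam 0 = 0 := by
  by_contra h
  obtain ⟨p, k, hp, h⟩ := Lam_ne_zero h
  exact hp.ne_zero (pow_eq_zero_iff (by omega) |>.1 h)

lemma Lam_le (d : ℤ[i]) : Lam d ≤ Real.log (nn d) := by
  classical
  rcases eq_or_ne d 0 with rfl | hd
  · rw [Lam_zero, nn_zero]; simp
  rw [← sum_Lam hd rfl]
  exact Finset.single_le_sum (f := Lam) (fun q _ => Lam_nonneg q)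
    (Finset.mem_filter.2 ⟨mem_Bl.2 le_rfl, dvd_rfl⟩)


lemma conv_eq (χ : ℤ[i] →* ℂ) {n : ℕ} (hn : n ≠ 0) :
    (LSeries.convolution (fold fun d => Lam d * χ d) (fold χ)) n = LSeries.logMul (fold χ) n := by
  classical
  rw [LSeries.convolution_def]
  simp only [LSeries.logMul, fold]
  have e : ∀ z ∈ S n, (Complex.log n) * χ z = ∑ d ∈ (Bl n).filter (· ∣ z), (Lam d : ℂ) * χ z := by
    intro z hz
    rw [mem_S] at hz
    have hz0 : z ≠ 0 := by rintro rfl; exact hn (hz ▸ nn_zero)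
    rw [← Finset.sum_mul, ← Complex.ofReal_sum, sum_Lam hz0 hz, hz, Complex.natCast_log]
  rw [Finset.mul_sum, Finset.sum_congr rfl e]
  simp only [Finset.sum_mul_sum, ← Finset.sum_product']
  rw [Finset.sum_sigma', Finset.sum_sigma']
  refine Finset.sum_bij' (fun x _ => ⟨x.2.1 * x.2.2, x.2.1⟩)
    (fun y _ => ⟨(nn y.2, nn (y.1 / y.2)), (y.2, y.1 / y.2)⟩) ?_ ?_ ?_ ?_ ?_
  · rintro ⟨⟨a, b⟩, ⟨d, e⟩⟩ h
    simp only [Finset.mem_sigma, Nat.mem_divisorsAntidiagonal, Finset.mem_product, mem_S] at h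
    obtain ⟨⟨h1, h2⟩, h3, h4⟩ := h
    simp only [Finset.mem_sigma, mem_S, Finset.mem_filter, mem_Bl]
    subst h3 h4
    refine ⟨by rw [nn_mul, h1], ?_, dvd_mul_right _ _⟩
    rw [← h1]
    exact Nat.le_mul_of_pos_right _ (Nat.pos_of_ne_zero (by rintro h; rw [h] at h1; simp at h1; exact hn h1.symm))
  · rintro ⟨z, d⟩ h
    simp only [Finset.mem_sigma, mem_S, Finset.mem_filter, mem_Bl] at h
    obtain ⟨h1, h2, e, rfl⟩ := h
    have hd : d ≠ 0 := by rintro rfl; rw [zero_mul, nn_zero] at h1; exact hn h1.symm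
    simp only [Finset.mem_sigma, Nat.mem_divisorsAntidiagonal, Finset.mem_product, mem_S,
      mul_div_cancel_left₀ e hd, ← nn_mul, h1]
    exact ⟨⟨trivial, hn⟩, trivial, trivial⟩
  · rintro ⟨⟨a, b⟩, ⟨d, e⟩⟩ h
    simp only [Finset.mem_sigma, Nat.mem_divisorsAntidiagonal, Finset.mem_product, mem_S] at h
    obtain ⟨⟨h1, h2⟩, rfl, rfl⟩ := h
    have hd : d ≠ 0 := by rintro rfl; rw [nn_zero, zero_mul] at h1; exact hn h1.symm
    simp only [mul_div_cancel_left₀ e hd]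
  · rintro ⟨z, d⟩ h
    simp only [Finset.mem_sigma, mem_S, Finset.mem_filter, mem_Bl] at h
    obtain ⟨h1, h2, e, rfl⟩ := h
    have hd : d ≠ 0 := by rintro rfl; rw [zero_mul, nn_zero] at h1; exact hn h1.symm
    simp only [mul_div_cancel_left₀ e hd]
  · rintro ⟨⟨a, b⟩, ⟨d, e⟩⟩ h
    simp only [map_mul]
    ring

end part3

section part4
open LSeries in
/-- `Λ(d)/log N(d)`. -/
noncomputable def Gl (d : ℤ[i]) : ℝ := Lam d / Real.log (nn d)

lemma log_nn_nonneg (d : ℤ[i]) : 0 ≤ Real.log (nn d) := Real.log_natCast_nonneg _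

lemma Gl_nonneg (d : ℤ[i]) : 0 ≤ Gl d := div_nonneg (Lam_nonneg d) (log_nn_nonneg d)

lemma Gl_le (d : ℤ[i]) : Gl d ≤ 1 := div_le_one_of_le₀ (Lam_le d) (log_nn_nonneg d)

lemma log_mul_Gl (d : ℤ[i]) : Real.log (nn d) * Gl d = Lam d := by
  by_cases h : Real.log (nn d) = 0
  · have h1 := Lam_le d
    have h2 := Lam_nonneg d
    rw [h, zero_mul]; linarith
  · rw [Gl]; field_simp

lemma norm_Gl_mul {g : ℤ[i] → ℂ} {C : ℝ} (hg : ∀ z, ‖g z‖ ≤ C) (z : ℤ[i]) :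
    ‖(Gl z : ℂ) * g z‖ ≤ C := by
  rw [norm_mul, Complex.norm_real, Real.norm_of_nonneg (Gl_nonneg z)]
  calc _ ≤ 1 * ‖g z‖ := by gcongr; exact Gl_le z
    _ ≤ C := by rw [one_mul]; exact hg z

lemma logMul_fold (g : ℤ[i] → ℂ) :
    LSeries.logMul (fold fun d => Gl d * g d) = fold (fun d => Lam d * g d) := by
  ext n
  rw [LSeries.logMul, fold, fold, Finset.mul_sum]
  refine Finset.sum_congr rfl fun z hz => ?_
  rw [mem_S] at hz
  rw [← log_mul_Gl z, hz, Complex.natCast_log.symm]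
  push_cast
  ring

noncomputable def PP (g : ℤ[i] → ℂ) (s : ℂ) : ℂ := LSeries (fold fun d => Lam d * g d) s
noncomputable def FF (g : ℤ[i] → ℂ) (s : ℂ) : ℂ := LSeries (fold fun d => Gl d * g d) s

lemma lt_of_abscissa {f : ℕ → ℂ} (h : LSeries.abscissaOfAbsConv f ≤ 1) {s : ℂ} (hs : 1 < s.re) :
    LSeries.abscissaOfAbsConv f < s.re := lt_of_le_of_lt h (by exact_mod_cast hs)

lemma abscissa_F {g : ℤ[i] → ℂ} {C : ℝ} (hg : ∀ z, ‖g z‖ ≤ C) :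
    LSeries.abscissaOfAbsConv (fold fun d => Gl d * g d) ≤ 1 := abscissa_fold (norm_Gl_mul hg)

lemma abscissa_P {g : ℤ[i] → ℂ} {C : ℝ} (hg : ∀ z, ‖g z‖ ≤ C) :
    LSeries.abscissaOfAbsConv (fold fun d => Lam d * g d) ≤ 1 := by
  rw [← logMul_fold, LSeries.abscissaOfAbsConv_logMul]; exact abscissa_F hg

lemma hasDerivAt_F {g : ℤ[i] → ℂ} {C : ℝ} (hg : ∀ z, ‖g z‖ ≤ C) {s : ℂ} (hs : 1 < s.re) :
    HasDerivAt (FF g) (-PP g s) s := by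
  have := LSeries_hasDerivAt (lt_of_abscissa (abscissa_F hg) hs)
  rwa [logMul_fold] at this

lemma hasDerivAt_L {χ : ℤ[i] →* ℂ} {C : ℝ} (hg : ∀ z, ‖χ z‖ ≤ C) {s : ℂ} (hs : 1 < s.re) :
    HasDerivAt (LSeries (fold χ)) (-(PP χ s * LSeries (fold χ) s)) s := by
  have := LSeries_hasDerivAt (lt_of_abscissa (abscissa_fold hg) hs)
  rw [PP, ← LSeries_convolution (lt_of_abscissa (abscissa_P hg) hs)
    (lt_of_abscissa (abscissa_fold hg) hs)]
  rwa [LSeries_congr (fun {n} hn => conv_eq χ hn)]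

lemma summable_Lam {g : ℤ[i] → ℂ} {C : ℝ} (hg : ∀ z, ‖g z‖ ≤ C) {s : ℂ} (hs : 1 < s.re) :
    Summable fun d => (Lam d * g d) * T s d := by
  set ε := (s.re - 1) / 2 with hε
  have he : 0 < ε := by rw [hε]; linarith
  refine Summable.of_norm_bounded (g := fun d : ℤ[i] => C / ε * (nn d : ℝ) ^ (-(s.re - ε)))
    ((summable_nn (by rw [hε]; linarith)).mul_left _) fun d => ?_
  rw [norm_mul, norm_mul, norm_T (by linarith), Complex.norm_real,
    Real.norm_of_nonneg (Lam_nonneg d)]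
  have hC : 0 ≤ C := (norm_nonneg _).trans (hg d)
  by_cases hd : d = 0
  · subst hd; rw [Lam_zero]; simp only [zero_mul]; positivity
  have hpos : (0 : ℝ) < nn d := by exact_mod_cast nn_pos hd
  have h1 : Lam d ≤ (nn d : ℝ) ^ ε / ε := (Lam_le d).trans (Real.log_le_rpow_div hpos.le he)
  have h2 : (nn d : ℝ) ^ (-(s.re - ε)) = (nn d : ℝ) ^ ε * (nn d : ℝ) ^ (-s.re) := by
    rw [← Real.rpow_add hpos]; ring_nf
  rw [h2]
  calc _ ≤ ((nn d : ℝ) ^ ε / ε * C) * (nn d : ℝ) ^ (-s.re) := by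
        gcongr
        exact hg d
    _ = _ := by ring

lemma P_eq {g : ℤ[i] → ℂ} {C : ℝ} (hg : ∀ z, ‖g z‖ ≤ C) {s : ℂ} (hs : 1 < s.re) :
    PP g s = ∑' d, (Lam d * g d) * T s d :=
  LSeries_fold (by rintro rfl; simp at hs; linarith) (summable_Lam hg hs)

lemma F_eq {g : ℤ[i] → ℂ} {C : ℝ} (hg : ∀ z, ‖g z‖ ≤ C) {s : ℂ} (hs : 1 < s.re) :
    FF g s = ∑' d, (Gl d * g d) * T s d :=
  LSeries_fold (by rintro rfl; simp at hs; linarith) (summable_mul_T (norm_Gl_mul hg) hs)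

lemma fold_one {χ : ℤ[i] →* ℂ} (hu : ∀ z, IsUnit z → χ z = 1) : fold χ 1 ≠ 0 := by
  have : fold χ 1 = ((S 1).card : ℂ) := by
    rw [fold, Finset.sum_congr rfl (g := fun _ => (1 : ℂ))]
    · simp
    · intro z hz; exact hu z (nn_eq_one.1 (mem_S.1 hz))
  rw [this, Nat.cast_ne_zero, Finset.card_ne_zero]
  exact ⟨1, mem_S.2 nn_one⟩

lemma exp_formula {χ : ℤ[i] →* ℂ} {C : ℝ} (hg : ∀ z, ‖χ z‖ ≤ C)
    (hu : ∀ z, IsUnit z → χ z = 1) :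
    ∃ K : ℂ, K ≠ 0 ∧ ∀ s : ℂ, 1 < s.re → LSeries (fold χ) s = K * Complex.exp (FF χ s) := by
  set D : Set ℂ := {s | 1 < s.re}
  have hD : Convex ℝ D := convex_halfSpace_re_gt 1
  have hDo : IsOpen D := isOpen_lt continuous_const Complex.continuous_re
  set f : ℂ → ℂ := fun s => LSeries (fold χ) s * Complex.exp (-FF χ s)
  have hf : ∀ s ∈ D, HasDerivAt f 0 s := by
    intro s hs
    have := (hasDerivAt_L hg hs).mul ((hasDerivAt_F hg hs).neg.cexp)
    refine HasDerivAt.congr_deriv (f := f) this ?_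
    ring
  have hconst : ∀ s ∈ D, f s = f 2 := by
    intro s hs
    refine hD.is_const_of_fderivWithin_eq_zero (𝕜 := ℂ)
      (fun x hx => (hf x hx).differentiableAt.differentiableWithinAt) (fun x hx => ?_) hs
      (by simp [D])
    rw [fderivWithin_of_isOpen hDo hx, (hf x hx).hasFDerivAt.fderiv]
    ext; simp
  have key : ∀ s ∈ D, LSeries (fold χ) s = f 2 * Complex.exp (FF χ s) := by
    intro s hs
    rw [← hconst s hs, mul_assoc, ← Complex.exp_add]; simp
  refine ⟨f 2, fun h0 => ?_, key⟩
  have ht := LSeries.tendsto_atTop (f := fold χ)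
    (lt_of_le_of_lt (abscissa_fold hg) (EReal.coe_lt_top 1))
  refine fold_one hu (tendsto_nhds_unique ht ?_)
  refine tendsto_const_nhds.congr' ?_
  filter_upwards [Filter.eventually_gt_atTop (1 : ℝ)] with x hx
  rw [key x (by simpa [D] using hx), h0, zero_mul]

lemma L_ne_zero {χ : ℤ[i] →* ℂ} {C : ℝ} (hg : ∀ z, ‖χ z‖ ≤ C)
    (hu : ∀ z, IsUnit z → χ z = 1) {s : ℂ} (hs : 1 < s.re) : LSeries (fold χ) s ≠ 0 := by
  obtain ⟨K, hK, h⟩ := exp_formula hg hu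
  rw [h s hs]; exact mul_ne_zero hK (Complex.exp_ne_zero _)
end part4

section part5
section chars
variable (μ : ℤ[i])

abbrev BQ : Type := ℤ[i] ⧸ Ideal.span {μ}

abbrev qm (z : ℤ[i]) : BQ μ := Ideal.Quotient.mk _ z

def GQ : Type := (BQ μ)ˣ ⧸
  (Units.map (Ideal.Quotient.mk (Ideal.span {μ}) : ℤ[i] →* BQ μ)).range

noncomputable instance : CommGroup (GQ μ) :=
  inferInstanceAs (CommGroup ((BQ μ)ˣ ⧸
    (Units.map (Ideal.Quotient.mk (Ideal.span {μ}) : ℤ[i] →* BQ μ)).range))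

instance [Finite (BQ μ)] : Finite (GQ μ) :=
  inferInstanceAs (Finite ((BQ μ)ˣ ⧸
    (Units.map (Ideal.Quotient.mk (Ideal.span {μ}) : ℤ[i] →* BQ μ)).range))

variable {μ}

/-- class of a unit -/
def cl (u : (BQ μ)ˣ) : GQ μ := QuotientGroup.mk u

noncomputable def preChar (ψ : AddChar (Additive (GQ μ)) ℂ) : (BQ μ)ˣ →* ℂ where
  toFun u := ψ (Additive.ofMul (cl u))
  map_one' := by
    have : Additive.ofMul (cl (1 : (BQ μ)ˣ)) = 0 := rfl
    rw [this, AddChar.map_zero_eq_one]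
  map_mul' u v := by
    have : Additive.ofMul (cl (u * v)) = Additive.ofMul (cl u) + Additive.ofMul (cl v) := rfl
    rw [this, AddChar.map_add_eq_mul]

noncomputable def mchar (ψ : AddChar (Additive (GQ μ)) ℂ) : MulChar (BQ μ) ℂ :=
  MulChar.ofUnitHom (preChar ψ).toHomUnits

lemma mchar_apply (ψ : AddChar (Additive (GQ μ)) ℂ) (u : (BQ μ)ˣ) :
    mchar ψ (u : BQ μ) = ψ (Additive.ofMul (cl u)) := by
  rw [mchar, MulChar.ofUnitHom_coe]; rfl

lemma mchar_ne_one {ψ : AddChar (Additive (GQ μ)) ℂ} (h : ψ ≠ 0) : mchar ψ ≠ 1 := by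
  intro h1
  apply h
  ext a
  obtain ⟨u, hu⟩ : ∃ u : (BQ μ)ˣ, Additive.ofMul (cl u) = a := QuotientGroup.mk_surjective a
  rw [← hu, ← mchar_apply, h1, MulChar.one_apply_coe]; simp

lemma cl_unit {z : ℤ[i]} (hz : IsUnit z) (u : (BQ μ)ˣ) (hu : (u : BQ μ) = qm μ z) :
    cl u = 1 := by
  refine (QuotientGroup.eq_one_iff u).2 ⟨hz.unit, ?_⟩
  ext; simp [hu]

lemma cl_eq {u v : (BQ μ)ˣ} (h : cl u = cl v) : ∃ w : ℤ[i], IsUnit w ∧ (v : BQ μ) = qm μ w * u := by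
  obtain ⟨w, hw⟩ := QuotientGroup.eq.1 h
  refine ⟨w, w.isUnit, ?_⟩
  have := congrArg Units.val hw
  have h2 : (v : BQ μ) = u * ((u⁻¹ * v : (BQ μ)ˣ) : BQ μ) := by simp
  rw [h2, ← this, mul_comm]; rfl

open Classical in
noncomputable def chi (ψ : AddChar (Additive (GQ μ)) ℂ) : ℤ[i] →* ℂ :=
  if ψ = 0 then 1 else (mchar ψ).toMonoidHom.comp (Ideal.Quotient.mk (Ideal.span {μ}) : ℤ[i] →* BQ μ)

lemma chi_zero (z : ℤ[i]) : chi (0 : AddChar (Additive (GQ μ)) ℂ) z = 1 := by simp [chi]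

lemma chi_of_ne {ψ : AddChar (Additive (GQ μ)) ℂ} (h : ψ ≠ 0) (z : ℤ[i]) :
    chi ψ z = mchar ψ (qm μ z) := by simp [chi, h]

lemma chi_unit {ψ : AddChar (Additive (GQ μ)) ℂ} {z : ℤ[i]} (u : (BQ μ)ˣ) (hu : (u : BQ μ) = qm μ z) :
    chi ψ z = ψ (Additive.ofMul (cl u)) := by
  by_cases h : ψ = 0
  · rw [h, chi_zero]; simp
  · rw [chi_of_ne h, ← hu, mchar_apply]

lemma chi_nonunit {ψ : AddChar (Additive (GQ μ)) ℂ} (h : ψ ≠ 0) {z : ℤ[i]} (hu : ¬ IsUnit (qm μ z)) :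
    chi ψ z = 0 := by
  rw [chi_of_ne h, MulChar.map_nonunit _ hu]

end chars

theorem characters {μ : ℤ[i]} (hμ : μ ≠ 0) {α : ℤ[i]} (hα : IsUnit (qm μ α)) :
    ∃ (ι : Type) (_ : Fintype ι) (_ : DecidableEq ι) (i0 : ι) (χ : ι → ℤ[i] →* ℂ) (w : ι → ℂ) (h : ℕ),
    (∀ i z, ‖χ i z‖ ≤ 1) ∧ (∀ i z, IsUnit z → χ i z = 1) ∧ (∀ z, χ i0 z = 1) ∧ w i0 = 1 ∧
    (∀ i, i ≠ i0 → ∃ L : ℂ → ℂ, DifferentiableOn ℂ L {s | 0 < s.re} ∧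
      ∀ s, 1 < s.re → L s = LSeries (fold (χ i)) s) ∧
    0 < h ∧ (∀ d, ∃ r : ℝ, 0 ≤ r ∧ ∑ i, χ i d = r) ∧ (∀ d, 1 ≤ (∑ i, χ i (d ^ h)).re) ∧
    (∀ d, ∑ i, w i * χ i d ≠ 0 → (∃ u, IsUnit u ∧ u * d - α ∈ Ideal.span {μ}) ∨
      ¬ IsUnit (qm μ d)) := by
  classical
  have : Finite (BQ μ) := finite_quot hμ
  let _ : Fintype (BQ μ) := Fintype.ofFinite _
  let _ : Fintype (Additive (GQ μ)) := Fintype.ofFinite _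
  obtain ⟨a, ha⟩ := hα
  have hsum : ∀ d, ∀ u : (BQ μ)ˣ, (u : BQ μ) = qm μ d →
      ∑ ψ : AddChar (Additive (GQ μ)) ℂ, chi ψ d =
      if cl u = 1 then (Fintype.card (Additive (GQ μ)) : ℂ) else 0 := by
    intro d u hu
    rw [Finset.sum_congr rfl fun ψ _ => chi_unit u hu, AddChar.sum_apply_eq_ite]
    rfl
  have hsum2 : ∀ d, ¬ IsUnit (qm μ d) → ∑ ψ : AddChar (Additive (GQ μ)) ℂ, chi ψ d = 1 := by
    intro d hd
    rw [Finset.sum_eq_single 0, chi_zero]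
    · intro b _ hb; exact chi_nonunit hb hd
    · simp
  have hbd : ∀ (ψ : AddChar (Additive (GQ μ)) ℂ) z, ‖chi ψ z‖ ≤ 1 := by
    intro ψ z
    by_cases hz : IsUnit (qm μ z)
    · obtain ⟨u, hu⟩ := hz
      rw [chi_unit u hu, AddChar.norm_apply]
    · by_cases h : ψ = 0
      · rw [h, chi_zero]; simp
      · rw [chi_nonunit h hz]; simp
  refine ⟨AddChar (Additive (GQ μ)) ℂ, inferInstance, inferInstance, 0, chi,
    fun ψ => ψ (-Additive.ofMul (cl a)), Fintype.card (Additive (GQ μ)), hbd, ?_, chi_zero, by simp,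
    ?_, Fintype.card_pos, ?_, ?_, ?_⟩
  · intro ψ z hz
    obtain ⟨u, hu⟩ : IsUnit (qm μ z) := hz.map (Ideal.Quotient.mk (Ideal.span {μ}))
    rw [chi_unit u hu, cl_unit hz u hu]
    exact AddChar.map_zero_eq_one ψ
  · intro ψ hψ
    obtain ⟨L, hL, hL2⟩ := continuation hμ (fun b => mchar ψ b)
      (MulChar.sum_eq_zero_of_ne_one (mchar_ne_one hψ))
    refine ⟨L, hL, fun s hs => ?_⟩
    rw [hL2 s hs, LSeries_fold (by rintro rfl; simp at hs; linarith)
      (summable_mul_T (hbd ψ) hs)]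
    exact tsum_congr fun z => by rw [chi_of_ne hψ]
  · intro d
    by_cases hd : IsUnit (qm μ d)
    · obtain ⟨u, hu⟩ := hd
      rw [hsum d u hu]
      split_ifs
      · exact ⟨_, Nat.cast_nonneg (Fintype.card (Additive (GQ μ))), by push_cast; rfl⟩
      · exact ⟨0, le_rfl, by simp⟩
    · exact ⟨1, zero_le_one, by rw [hsum2 d hd]; simp⟩
  · intro d
    by_cases hd : IsUnit (qm μ (d ^ Fintype.card (Additive (GQ μ))))
    · obtain ⟨u, hu⟩ := id hd
      have hd' : IsUnit (qm μ d) := by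
        rw [qm, map_pow] at hd
        exact (isUnit_pow_iff Fintype.card_ne_zero).1 hd
      obtain ⟨v, hv⟩ := hd'
      have huv : u = v ^ Fintype.card (Additive (GQ μ)) := by
        ext; rw [hu, Units.val_pow_eq_pow_val, hv]; simp
      rw [hsum _ u hu, if_pos]
      · simp only [Complex.natCast_re, Nat.one_le_cast]
        exact Fintype.card_pos
      · rw [huv]
        have := card_nsmul_eq_zero (G := Additive (GQ μ)) (x := Additive.ofMul (cl v))
        exact this
    · rw [hsum2 _ hd]; simp
  · intro d hd
    by_cases hu : IsUnit (qm μ d)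
    · left
      obtain ⟨u, hu⟩ := hu
      have : ∑ ψ : AddChar (Additive (GQ μ)) ℂ, ψ (-Additive.ofMul (cl a)) * chi ψ d =
        ∑ ψ : AddChar (Additive (GQ μ)) ℂ, ψ (-Additive.ofMul (cl a) + Additive.ofMul (cl u)) := by
        refine Finset.sum_congr rfl fun ψ _ => ?_
        rw [chi_unit u hu, AddChar.map_add_eq_mul]
      rw [this, AddChar.sum_apply_eq_ite] at hd
      have h0 : -Additive.ofMul (cl a) + Additive.ofMul (cl u) = 0 := by
        by_contra h; rw [if_neg h] at hd; exact hd rfl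
      have h1 : cl u = cl a := by
        have := neg_add_eq_zero.1 h0
        exact this.symm
      obtain ⟨w, hw, hw2⟩ := cl_eq h1
      refine ⟨w, hw, ?_⟩
      rw [← Ideal.Quotient.eq, ← qm, ← qm, ← ha, hw2, hu]; simp
    · exact Or.inr hu
end part5

section part6
lemma card_quot_two [Fintype (ℤ[i] ⧸ Ideal.span {(2 : ℤ[i])})] :
    Fintype.card (ℤ[i] ⧸ Ideal.span {(2 : ℤ[i])}) = 4 := by
  have hd : ∀ z : ℤ[i], (2 : ℤ[i]) ∣ z ↔ (2 : ℤ) ∣ z.re ∧ (2 : ℤ) ∣ z.im := by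
    intro z
    have := Zsqrtd.intCast_dvd (d := -1) 2 z
    exact_mod_cast this
  let g : Fin 2 × Fin 2 → ℤ[i] ⧸ Ideal.span {(2 : ℤ[i])} := fun p =>
    Ideal.Quotient.mk _ (⟨(p.1 : ℕ), (p.2 : ℕ)⟩ : ℤ[i])
  have hg : Function.Bijective g := by
    constructor
    · rintro ⟨a, b⟩ ⟨c, d⟩ h
      have h1 := Ideal.mem_span_singleton.1 (Ideal.Quotient.eq.1 h)
      rw [hd] at h1
      simp only [Zsqrtd.re_sub, Zsqrtd.im_sub] at h1
      have := a.2; have := b.2; have := c.2; have := d.2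
      simp only [Prod.mk.injEq, Fin.ext_iff]
      omega
    · intro x
      obtain ⟨z, rfl⟩ := Ideal.Quotient.mk_surjective x
      refine ⟨(⟨(z.re % 2).toNat, by omega⟩, ⟨(z.im % 2).toNat, by omega⟩), ?_⟩
      refine Ideal.Quotient.eq.2 (Ideal.mem_span_singleton.2 ?_)
      rw [hd]
      simp only [Zsqrtd.re_sub, Zsqrtd.im_sub]
      omega
  rw [← Fintype.card_of_bijective hg]; simp

noncomputable def qf (s : ℂ) : ℂ := 1 - Complex.exp ((1 - s) * Real.log 4)

lemma hasDerivAt_q (s : ℂ) :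
    HasDerivAt qf (Complex.exp ((1 - s) * Real.log 4) * Real.log 4) s := by
  have h : HasDerivAt (fun s : ℂ => (1 - s) * (Real.log 4 : ℂ)) (-1 * Real.log 4) s :=
    ((hasDerivAt_id s).const_sub 1).mul_const _
  refine (h.cexp.const_sub 1).congr_deriv ?_
  ring

lemma differentiable_q : Differentiable ℂ qf := fun s => (hasDerivAt_q s).differentiableAt

lemma q_one : qf 1 = 0 := by simp [qf]

lemma log4 : 0 < Real.log 4 ∧ Real.log 4 < 2 := by
  have : Real.log 4 = 2 * Real.log 2 := by
    rw [show (4 : ℝ) = 2 ^ 2 by norm_num, Real.log_pow]; norm_num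
  have h1 := Real.log_two_gt_d9
  have h2 := Real.log_two_lt_d9
  rw [this]; constructor <;> linarith

lemma q_ne {s : ℂ} (hs : s ∈ Metric.ball (2 : ℂ) 2) (h1 : s ≠ 1) : qf s ≠ 0 := by
  intro h
  rw [qf, sub_eq_zero, eq_comm, Complex.exp_eq_one_iff] at h
  obtain ⟨n, hn⟩ := h
  have hl := log4
  generalize Real.log 4 = l at hl hn
  have him := congrArg Complex.im hn
  have hre := congrArg Complex.re hn
  simp [Complex.mul_im, Complex.mul_re] at him hre
  have hs2 : |s.im| < 2 := by
    have := Complex.abs_im_le_norm (s - 2)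
    rw [Metric.mem_ball, dist_eq_norm] at hs
    simp at this; linarith
  by_cases hn0 : n = 0
  · subst hn0
    apply h1
    apply Complex.ext
    · rcases hre with h | h
      · simp; linarith
      · linarith
    · rw [Int.cast_zero, zero_mul, neg_eq_zero, mul_eq_zero] at him
      rcases him with h | h
      · simpa using h
      · linarith
  · have h2 : (1 : ℝ) ≤ |(n : ℝ)| := by
      rw [← Int.cast_abs]; exact_mod_cast Int.one_le_abs hn0
    have h3 : |s.im| * l = |(n : ℝ)| * (2 * Real.pi) := by
      have := congrArg abs him
      rw [abs_neg, abs_mul, abs_mul, abs_of_pos hl.1, abs_of_pos Real.two_pi_pos] at this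
      exact this
    have := Real.pi_gt_three
    nlinarith [abs_nonneg s.im]

lemma zeta_cont : ∃ A : ℂ → ℂ, DifferentiableOn ℂ A {s | 0 < s.re} ∧
    ∀ s, 1 < s.re → A s = qf s * LSeries (fold fun _ => 1) s := by
  classical
  have h2 : (2 : ℤ[i]) ≠ 0 := by norm_num
  have : Finite (ℤ[i] ⧸ Ideal.span {(2 : ℤ[i])}) := finite_quot h2
  let _ : Fintype (ℤ[i] ⧸ Ideal.span {(2 : ℤ[i])}) := Fintype.ofFinite _
  obtain ⟨L, hL, hL2⟩ := continuation h2 (fun b => 1 - 4 * if b = 0 then 1 else 0) (by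
    rw [Finset.sum_sub_distrib, ← Finset.mul_sum]
    simp [card_quot_two])
  refine ⟨L, hL, fun s hs => ?_⟩
  have hs0 : s ≠ 0 := by rintro rfl; simp at hs; linarith
  have hsm : Summable fun z => (1 : ℂ) * T s z := summable_mul_T (C := 1) (by simp) hs
  rw [hL2 s hs, LSeries_fold hs0 hsm]
  have e1 : ∀ z : ℤ[i], (if (Ideal.Quotient.mk (Ideal.span {(2 : ℤ[i])}) z) = 0 then (1 : ℂ) else 0)
      = if 2 ∣ z then 1 else 0 := by
    intro z; simp only [Ideal.Quotient.eq_zero_iff_mem, Ideal.mem_span_singleton]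
  have hT : ∀ w, T s (2 * w) = (4 : ℂ) ^ (-s) * T s w := by
    intro w
    have : nn 2 = 4 := by have := nn_eq 2; simp at this; exact_mod_cast this
    rw [T, T, nn_mul, this, Nat.cast_mul, Complex.natCast_mul_natCast_cpow]
    norm_num
  have hs2 : Summable fun z => (if 2 ∣ z then (1 : ℂ) else 0) * T s z :=
    summable_mul_T (C := 1) (fun z => by split_ifs <;> simp) hs
  have h3 : ∑' z, (if 2 ∣ z then (1 : ℂ) else 0) * T s z = 4 ^ (-s) * ∑' z, 1 * T s z := by
    have hinj : Function.Injective (fun w : ℤ[i] => 2 * w) := mul_right_injective₀ h2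
    rw [← hinj.tsum_eq, ← tsum_mul_left]
    · exact tsum_congr fun w => by rw [hT]; simp
    · intro z hz
      rw [Function.mem_support] at hz
      by_cases h : 2 ∣ z
      · obtain ⟨w, rfl⟩ := h; exact ⟨w, rfl⟩
      · simp [h] at hz
  have h4 : ∀ z, (1 - 4 * if (Ideal.Quotient.mk (Ideal.span {(2 : ℤ[i])}) z) = 0 then (1 : ℂ) else 0) * T s z
      = 1 * T s z - 4 * ((if 2 ∣ z then (1 : ℂ) else 0) * T s z) := by
    intro z; rw [e1]; ring
  rw [tsum_congr h4, hsm.tsum_sub (hs2.mul_left 4), tsum_mul_left (a := (4 : ℂ)), h3]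
  have h5 : Complex.exp ((1 - s) * Real.log 4) = 4 * 4 ^ (-s) := by
    rw [Complex.cpow_def_of_ne_zero (by norm_num), Complex.ofReal_log (by norm_num)]
    rw [sub_mul, one_mul, sub_eq_add_neg, Complex.exp_add]
    push_cast
    rw [Complex.exp_log (by norm_num)]
    ring_nf
  rw [qf, h5]; ring
end part6

section part7
section landau
open scoped ComplexOrder Topology

lemma alternating {W Q : ℂ → ℂ} {c : ℂ} (hW : ContDiffAt ℂ (⊤ : ℕ∞) W c)
    (hQ : ContDiffAt ℂ (⊤ : ℕ∞) Q c) (hd : deriv W =ᶠ[𝓝 c] -(Q * W))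
    (hQ0 : ∀ n, 0 ≤ (-1) ^ n * iteratedDeriv n Q c) (hW0 : 0 ≤ W c) (n : ℕ) :
    0 ≤ (-1) ^ n * iteratedDeriv n W c := by
  induction n using Nat.strong_induction_on with
  | _ n ih =>
  rcases n with _ | n
  · simpa using hW0
  · rw [iteratedDeriv_succ', hd.iteratedDeriv_eq, iteratedDeriv_neg,
      iteratedDeriv_mul (hQ.of_le (by exact_mod_cast le_top)) (hW.of_le (by exact_mod_cast le_top)),
      pow_succ, mul_assoc, neg_one_mul, neg_neg, Finset.mul_sum]
    refine Finset.sum_nonneg fun i hi => ?_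
    have hi' : i ≤ n := by simpa [Nat.lt_succ_iff] using hi
    have h1 := mul_nonneg (mul_nonneg (Nat.cast_nonneg (α := ℂ) (n.choose i)) (hQ0 i))
      (ih (n - i) (by omega))
    have h2 : (-1 : ℂ) ^ n = (-1) ^ i * (-1) ^ (n - i) := by rw [← pow_add]; congr 1; omega
    rw [h2]
    convert h1 using 1
    ring

lemma ball_alternating {f : ℂ → ℂ} {c : ℂ} {r : ℝ}
    (hf : DifferentiableOn ℂ f (Metric.ball c r))
    (h : ∀ n, 0 ≤ (-1) ^ n * iteratedDeriv n f c) ⦃z : ℂ⦄ (hz : z ≤ c)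
    (hz2 : z ∈ Metric.ball c r) : f c ≤ f z := by
  have hm : Set.MapsTo (fun z : ℂ => -z) (Metric.ball (-c) r) (Metric.ball c r) := by
    intro w hw
    rw [Metric.mem_ball] at hw ⊢
    rwa [← dist_neg_neg, neg_neg]
  have hg : DifferentiableOn ℂ (fun w => f (-w) - f c) (Metric.ball (-c) r) :=
    (hf.comp differentiable_neg.differentiableOn hm).sub_const _
  have := hg.nonneg_of_iteratedDeriv_nonneg (fun n => ?_) (neg_le_neg_iff.mpr hz) (by
    rw [Metric.mem_ball, dist_neg_neg]; exact hz2)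
  · simpa using this
  · rcases n with _ | n
    · simp
    · rw [iteratedDeriv_succ', funext fun x ↦ deriv_sub_const (f := fun w => f (-w)) (x := x) (f c),
        ← iteratedDeriv_succ']
      simpa only [iteratedDeriv_comp_neg, neg_neg, smul_eq_mul] using h (n + 1)

lemma fold_nonneg {g : ℤ[i] → ℂ} (hg : ∀ d, 0 ≤ g d) : 0 ≤ fold fun d => Lam d * g d := by
  intro n
  refine Finset.sum_nonneg fun d _ => mul_nonneg ?_ (hg d)
  exact Complex.zero_le_real.2 (Lam_nonneg d)

lemma hasDerivAt_GT (d : ℤ[i]) (s : ℂ) :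
    HasDerivAt (fun s => (Gl d : ℂ) * T s d) (-(Lam d * T s d)) s := by
  by_cases hd : d = 0
  · have h1 : Lam d = 0 := by rw [hd, Lam_zero]
    have h2 : Gl d = 0 := by rw [Gl, h1, zero_div]
    simp only [h1, h2, Complex.ofReal_zero, zero_mul, neg_zero]
    exact hasDerivAt_const s 0
  have h0 : (nn d : ℂ) ≠ 0 := by exact_mod_cast (nn_pos hd).ne'
  have h := ((hasDerivAt_neg s).const_cpow (c := (nn d : ℂ)) (Or.inl h0)).const_mul (Gl d : ℂ)
  refine h.congr_deriv ?_
  rw [← log_mul_Gl, T, ← Complex.natCast_log]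
  push_cast
  ring

lemma T_real {σ : ℝ} (_ : 0 < σ) (d : ℤ[i]) : T σ d = (((nn d : ℝ) ^ (-σ) : ℝ) : ℂ) := by
  rw [T, Complex.ofReal_cpow (by positivity)]; push_cast; rfl

lemma Gl_ne_zero {d : ℤ[i]} (h : Gl d ≠ 0) : 2 ≤ nn d := by
  have h1 : Lam d ≠ 0 := by intro h1; apply h; rw [Gl, h1, zero_div]
  by_contra h2
  have h3 : nn d = 0 ∨ nn d = 1 := by omega
  apply h
  rcases h3 with h3 | h3 <;> simp [Gl, h3]

theorem landau {Φ : ℤ[i] → ℝ} {C : ℝ} (h0 : ∀ d, 0 ≤ Φ d) (hC : ∀ d, Φ d ≤ C) {Z : ℂ → ℂ}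
    (hZ : DifferentiableOn ℂ Z (Metric.ball 2 2)) (hZ2 : Z 2 ≠ 0)
    (hd : ∀ s : ℂ, 1 < s.re → HasDerivAt Z (-(PP (fun d => Φ d) s * Z s)) s)
    {σ : ℝ} (hσ0 : 0 < σ) (hσ1 : σ < 1) :
    Summable fun d => Gl d * Φ d * (nn d : ℝ) ^ (-σ) := by
  classical
  set M := ‖Z σ / Z 2‖
  refine summable_of_sum_le (c := 2 * M) (fun d => by
    have := h0 d; have := Gl_nonneg d; positivity) fun F => ?_
  set E : ℂ → ℂ := fun s => ∑ d ∈ F, Φ d * ((Gl d : ℂ) * T s d) with hE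
  have hEd : ∀ s, HasDerivAt E (-∑ d ∈ F, Φ d * (Lam d * T s d)) s := by
    intro s
    refine (HasDerivAt.fun_sum fun d (_ : d ∈ F) =>
      (hasDerivAt_GT d s).const_mul (Φ d : ℂ)).congr_deriv ?_
    rw [← Finset.sum_neg_distrib]
    exact Finset.sum_congr rfl fun d _ => by ring
  set Er : ℝ → ℝ := fun σ => ∑ d ∈ F, Gl d * Φ d * (nn d : ℝ) ^ (-σ) with hEr
  have hEE : ∀ σ : ℝ, 0 < σ → E σ = Er σ := by
    intro σ hσ
    simp only [hE, hEr]
    push_cast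
    refine Finset.sum_congr rfl fun d _ => ?_
    rw [T_real hσ]; push_cast; ring
  set W : ℂ → ℂ := fun s => Z s / Z 2 * Complex.exp (-E s) with hW
  set g : ℤ[i] → ℂ := fun d => if d ∈ F then 0 else (Φ d : ℂ) with hg
  have hΦb : ∀ z, ‖(Φ z : ℂ)‖ ≤ C := by
    intro z; rw [Complex.norm_real, Real.norm_of_nonneg (h0 z)]; exact hC z
  have hgb : ∀ z, ‖g z‖ ≤ C := by
    intro z; simp only [hg]; split_ifs
    · simpa using (h0 z).trans (hC z)
    · exact hΦb z
  have hPP : ∀ s : ℂ, 1 < s.re → PP (fun d => Φ d) s = PP g s + ∑ d ∈ F, Φ d * (Lam d * T s d) := by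
    intro s hs
    rw [P_eq hΦb hs, P_eq hgb hs]
    have : ∑ d ∈ F, Φ d * (Lam d * T s d) =
        ∑' d, (if d ∈ F then Φ d * (Lam d * T s d) else 0) := by
      rw [tsum_eq_sum (s := F)]
      · exact Finset.sum_congr rfl fun d hd => by rw [if_pos hd]
      · intro d hd; rw [if_neg hd]
    rw [this, ← (summable_Lam hgb hs).tsum_add]
    · refine tsum_congr fun d => ?_
      simp only [hg]; split_ifs <;> ring
    · exact summable_of_ne_finset_zero (s := F) fun d hd => by rw [if_neg hd]
  have hWd : ∀ s : ℂ, 1 < s.re → HasDerivAt W (-(PP g s * W s)) s := by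
    intro s hs
    refine HasDerivAt.congr_deriv (f := W) (((hd s hs).div_const (Z 2)).mul (hEd s).neg.cexp) ?_
    simp only [hW, hPP s hs, Pi.neg_apply]
    ring
  have hWdiff : DifferentiableOn ℂ W (Metric.ball 2 2) := by
    refine (hZ.div_const _).mul ?_
    exact fun s _ => ((hEd s).neg.cexp).differentiableAt.differentiableWithinAt
  have hopen : {s : ℂ | 1 < s.re} ∈ 𝓝 (2 : ℂ) :=
    (isOpen_lt continuous_const Complex.continuous_re).mem_nhds (by simp)
  have hW2 : W 2 = (Real.exp (-Er 2) : ℝ) := by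
    have := hEE 2 two_pos
    push_cast at this
    simp only [hW, this, div_self hZ2, one_mul]
    push_cast; rfl
  have habs : LSeries.abscissaOfAbsConv (fold fun d => Lam d * g d) < ((2 : ℝ) : EReal) :=
    lt_of_le_of_lt (abscissa_P hgb) (by exact_mod_cast one_lt_two)
  have halt : ∀ n, 0 ≤ (-1) ^ n * iteratedDeriv n W 2 := by
    refine alternating (Q := PP g) ?_ ?_ ?_ ?_ ?_
    · exact (hWdiff.analyticAt (Metric.ball_mem_nhds _ two_pos)).contDiffAt
    · have : DifferentiableOn ℂ (PP g) {s : ℂ | 1 < s.re} := fun s hs =>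
        (LSeries_hasDerivAt (lt_of_abscissa (abscissa_P hgb) hs)).differentiableAt.differentiableWithinAt
      exact (this.analyticAt hopen).contDiffAt
    · filter_upwards [hopen] with s hs
      exact (hWd s hs).deriv
    · intro n
      have := LSeries.iteratedDeriv_alternating (x := 2) (fold_nonneg (g := g) fun d => by
        simp only [hg]; split_ifs
        · exact le_rfl
        · exact_mod_cast h0 d) habs n
      exact_mod_cast this
    · rw [hW2]; exact_mod_cast (Real.exp_pos _).le
  have hle := ball_alternating hWdiff halt (z := (σ : ℂ))
    (by rw [show (2 : ℂ) = ((2 : ℝ) : ℂ) by norm_num]; exact_mod_cast (by linarith : σ ≤ 2))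
    (by
      rw [Metric.mem_ball, show (2 : ℂ) = ((2 : ℝ) : ℂ) by norm_num, dist_eq_norm,
        ← Complex.ofReal_sub, Complex.norm_real, Real.norm_eq_abs, abs_lt]
      constructor <;> linarith)
  have hle2 : Real.exp (-Er 2) ≤ M * Real.exp (-Er σ) := by
    have h1 := (Complex.le_def.1 hle).1
    rw [hW2, Complex.ofReal_re] at h1
    refine h1.trans ((Complex.re_le_norm _).trans ?_)
    simp only [hW, hEE σ hσ0]
    rw [norm_mul, ← Complex.ofReal_neg, ← Complex.ofReal_exp, Complex.norm_real,
      Real.norm_of_nonneg (Real.exp_pos _).le]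
  have hle3 : Er σ - Er 2 ≤ M := by
    have h1 := Real.add_one_le_exp (Er σ - Er 2)
    have h2 : Real.exp (Er σ - Er 2) ≤ M := by
      have h3 : Real.exp (Er σ - Er 2) = Real.exp (Er σ) * Real.exp (-Er 2) := by
        rw [← Real.exp_add]; ring_nf
      have h4 : M = Real.exp (Er σ) * (M * Real.exp (-Er σ)) := by
        rw [mul_left_comm, ← Real.exp_add]; simp
      rw [h3, h4]; gcongr
    linarith
  have hhalf : Er 2 ≤ Er σ / 2 := by
    simp only [hEr]
    rw [Finset.sum_div]
    refine Finset.sum_le_sum fun d _ => ?_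
    by_cases hG : Gl d = 0
    · simp [hG]
    have h2 := Gl_ne_zero hG
    have h2' : (2 : ℝ) ≤ nn d := by exact_mod_cast h2
    have hpos : (0 : ℝ) < nn d := by linarith
    rw [mul_div_assoc]
    refine mul_le_mul_of_nonneg_left ?_ (mul_nonneg (Gl_nonneg d) (h0 d))
    have : (nn d : ℝ) ^ (-(2 : ℝ)) ≤ (nn d : ℝ) ^ (-σ - 1) :=
      Real.rpow_le_rpow_of_exponent_le (by linarith) (by linarith)
    refine this.trans ?_
    rw [Real.rpow_sub_one hpos.ne']
    gcongr
  linarith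

end landau
end part7

section part8
lemma q_ne' {s : ℂ} (hs : 1 < s.re) : qf s ≠ 0 := by
  intro h
  rw [qf, sub_eq_zero] at h
  have h1 := congrArg norm h
  rw [Complex.norm_exp, norm_one, eq_comm, Real.exp_eq_one_iff, Complex.re_mul_ofReal] at h1
  simp only [Complex.sub_re, Complex.one_re] at h1
  nlinarith [log4.1]

lemma exists_prime_dvd (p : Nat.Primes) : ∃ π : ℤ[i], Prime π ∧ nn π ∣ (p : ℕ) ^ 2 := by
  have h1 : nn ((p : ℕ) : ℤ[i]) = (p : ℕ) ^ 2 := by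
    have := nn_eq ((p : ℕ) : ℤ[i])
    simp at this
    zify
    rw [this]; ring
  have h2 : ¬ IsUnit ((p : ℕ) : ℤ[i]) := by
    rw [← nn_eq_one, h1]
    have := p.2.two_le
    nlinarith
  have h3 : ((p : ℕ) : ℤ[i]) ≠ 0 := by exact_mod_cast p.2.ne_zero
  obtain ⟨π, hπ, w, hw⟩ := WfDvdMonoid.exists_irreducible_factor h2 h3
  refine ⟨π, hπ.prime, nn w, ?_⟩
  rw [← h1, hw, nn_mul]

lemma not_summable_Gl {Φ : ℤ[i] → ℝ} {h : ℕ} (hh : 0 < h) (h0 : ∀ d, 0 ≤ Φ d)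
    (h1 : ∀ d, 1 ≤ Φ (d ^ h)) :
    ¬ Summable fun d => Gl d * Φ d * (nn d : ℝ) ^ (-(1 / (2 * h) : ℝ)) := by
  intro hs
  choose π hπ hd using exists_prime_dvd
  have hinj : Function.Injective fun p => π p ^ h := by
    intro p q hpq
    by_contra hne
    have h2 := congrArg nn hpq
    simp only [nn_pow] at h2
    have h3 : nn (π p) = nn (π q) := Nat.pow_left_injective hh.ne' h2
    have h4 : Nat.Coprime ((p : ℕ) ^ 2) ((q : ℕ) ^ 2) :=
      Nat.Coprime.pow _ _ ((Nat.coprime_primes p.2 q.2).2 fun h => hne (Subtype.ext h))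
    have h5 := Nat.eq_one_of_dvd_coprimes h4 (hd p) (h3 ▸ hd q)
    have := two_le_nn (hπ p)
    omega
  have hs2 := (hs.comp_injective hinj).mul_left (cu * h)
  apply Nat.Primes.not_summable_one_div
  refine Summable.of_nonneg_of_le (fun p => by positivity) (fun p => ?_) hs2
  have hn2 : (2 : ℝ) ≤ nn (π p) := by exact_mod_cast two_le_nn (hπ p)
  have hnpos : (0 : ℝ) < nn (π p) := by linarith
  have hh' : (0 : ℝ) < h := by exact_mod_cast hh
  have hc := cu_pos
  have hlog : 0 < Real.log (nn (π p)) := Real.log_pos (by linarith)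
  have hG : (cu * h)⁻¹ ≤ Gl (π p ^ h) := by
    obtain ⟨k, rfl⟩ := Nat.exists_eq_succ_of_ne_zero hh.ne'
    have := le_Lam (hπ p) k
    rw [Gl, le_div_iff₀]
    · refine le_trans (le_of_eq ?_) this
      rw [nn_pow, Nat.cast_pow, Real.log_pow]
      field_simp
    · rw [nn_pow, Nat.cast_pow, Real.log_pow]; positivity
  have hr : ((p : ℕ) : ℝ)⁻¹ ≤ (nn (π p ^ h) : ℝ) ^ (-(1 / (2 * h) : ℝ)) := by
    rw [nn_pow, Nat.cast_pow, ← Real.rpow_natCast, ← Real.rpow_mul hnpos.le]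
    have e : (h : ℝ) * -(1 / (2 * h)) = -(1 / 2) := by field_simp
    rw [e, Real.rpow_neg hnpos.le, ← Real.sqrt_eq_rpow]
    have hle : (nn (π p) : ℝ) ≤ ((p : ℕ) : ℝ) ^ 2 := by
      exact_mod_cast Nat.le_of_dvd (pow_pos p.2.pos 2) (hd p)
    gcongr
    exact Real.sqrt_le_iff.2 ⟨by positivity, hle⟩
  simp only [Function.comp]
  have hcu : (0 : ℝ) < cu * h := by positivity
  calc (1 / ((p : ℕ) : ℝ)) = cu * h * ((cu * h)⁻¹ * 1 * ((p : ℕ) : ℝ)⁻¹) := by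
        field_simp
    _ ≤ _ := by
        gcongr
        · exact mul_nonneg (Gl_nonneg _) (h0 _)
        · exact Gl_nonneg _
        · exact h1 _

theorem nonvanish {ι : Type} [Fintype ι] [DecidableEq ι] {i0 : ι} {χ : ι → ℤ[i] →* ℂ} {h : ℕ}
    (hb : ∀ i z, ‖χ i z‖ ≤ 1) (hu : ∀ i z, IsUnit z → χ i z = 1) (h1 : ∀ z, χ i0 z = 1)
    {L : ι → ℂ → ℂ}
    (hL : ∀ i, i ≠ i0 → DifferentiableOn ℂ (L i) {s | 0 < s.re})
    (hL2 : ∀ i, i ≠ i0 → ∀ s, 1 < s.re → L i s = LSeries (fold (χ i)) s)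
    (hh : 0 < h) (hΦ : ∀ d, ∃ r : ℝ, 0 ≤ r ∧ ∑ i, χ i d = r)
    (hΦ1 : ∀ d, 1 ≤ (∑ i, χ i (d ^ h)).re) : ∀ i, i ≠ i0 → L i 1 ≠ 0 := by
  intro i1 hi1 hzero
  obtain ⟨A, hA, hA2⟩ := zeta_cont
  choose Φ hΦ0 hΦe using hΦ
  have hΦC : ∀ d, Φ d ≤ Fintype.card ι := by
    intro d
    have : ‖∑ i, χ i d‖ ≤ Fintype.card ι := by
      refine (norm_sum_le _ _).trans ((Finset.sum_le_sum fun i _ => hb i d).trans ?_)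
      simp
    rw [hΦe, Complex.norm_real, Real.norm_of_nonneg (hΦ0 d)] at this
    exact this
  have hsub : Metric.ball (2 : ℂ) 2 ⊆ {s | 0 < s.re} := by
    intro s hs
    have := Complex.abs_re_le_norm (s - 2)
    rw [Metric.mem_ball, dist_eq_norm] at hs
    have h3 := (abs_lt.1 (this.trans_lt hs)).1
    simp at h3
    simpa using h3
  have hmem : (1 : ℂ) ∈ Metric.ball (2 : ℂ) 2 := by
    rw [Metric.mem_ball, dist_eq_norm]; norm_num
  have hnhds : Metric.ball (2 : ℂ) 2 ∈ nhds (1 : ℂ) := Metric.isOpen_ball.mem_nhds hmem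
  set Z : ℂ → ℂ := fun s => A s * (dslope (L i1) 1 s / dslope qf 1 s) *
    ∏ i ∈ (Finset.univ.erase i0).erase i1, L i s with hZ
  have hZd : DifferentiableOn ℂ Z (Metric.ball 2 2) := by
    refine ((hA.mono hsub).mul (DifferentiableOn.div ?_ ?_ ?_)).mul ?_
    · exact (Complex.differentiableOn_dslope hnhds).2 ((hL i1 hi1).mono hsub)
    · exact (Complex.differentiableOn_dslope hnhds).2 differentiable_q.differentiableOn
    · intro s hs
      by_cases hs1 : s = 1
      · rw [hs1, dslope_same, (hasDerivAt_q 1).deriv]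
        refine mul_ne_zero (Complex.exp_ne_zero _) ?_
        exact_mod_cast log4.1.ne'
      · rw [dslope_of_ne _ hs1, slope_def_field, q_one, sub_zero]
        exact div_ne_zero (q_ne hs hs1) (sub_ne_zero.2 hs1)
    · refine DifferentiableOn.fun_finsetProd fun i hi => ?_
      simp only [Finset.mem_erase] at hi
      exact (hL i hi.2.1).mono hsub
  have hZe : ∀ s : ℂ, 1 < s.re → Z s = ∏ i, LSeries (fold (χ i)) s := by
    intro s hs
    have hs1 : s ≠ 1 := by rintro rfl; simp at hs
    have e0 : ((χ i0 : ℤ[i] →* ℂ) : ℤ[i] → ℂ) = fun _ => 1 := funext h1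
    rw [← Finset.mul_prod_erase _ _ (Finset.mem_univ i0),
      ← Finset.mul_prod_erase _ _ (Finset.mem_erase.2 ⟨hi1, Finset.mem_univ i1⟩)]
    simp only [hZ]
    rw [dslope_of_ne _ hs1, dslope_of_ne _ hs1, slope_def_field, slope_def_field, q_one, hzero,
      sub_zero, sub_zero, hA2 s hs, e0, hL2 i1 hi1 s hs, mul_assoc]
    rw [Finset.prod_congr rfl fun i hi => hL2 i (Finset.mem_erase.1 (Finset.mem_erase.1 hi).2).1 s hs]
    rw [← mul_assoc, ← mul_assoc]
    congr 1
    have := q_ne' hs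
    have := sub_ne_zero.2 hs1
    field_simp
  have hZ2 : Z 2 ≠ 0 := by
    rw [hZe 2 (by simp), Finset.prod_ne_zero_iff]
    intro i _
    exact L_ne_zero (hb i) (hu i) (by simp)
  have hPP : ∀ s : ℂ, 1 < s.re → PP (fun d => Φ d) s = ∑ i, PP (χ i) s := by
    intro s hs
    rw [P_eq (C := Fintype.card ι) _ hs]
    · rw [Finset.sum_congr rfl fun i _ => P_eq (hb i) hs,
        ← Summable.tsum_finsetSum fun i _ => summable_Lam (hb i) hs]
      refine tsum_congr fun d => ?_
      rw [← hΦe, Finset.mul_sum, Finset.sum_mul]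
    · intro z; rw [Complex.norm_real, Real.norm_of_nonneg (hΦ0 z)]; exact hΦC z
  have hd : ∀ s : ℂ, 1 < s.re → HasDerivAt Z (-(PP (fun d => Φ d) s * Z s)) s := by
    intro s hs
    have hopen : {s : ℂ | 1 < s.re} ∈ nhds s :=
      (isOpen_lt continuous_const Complex.continuous_re).mem_nhds hs
    have he : Z =ᶠ[nhds s] fun s => ∏ i, LSeries (fold (χ i)) s := by
      filter_upwards [hopen] with t ht using hZe t ht
    refine HasDerivAt.congr_of_eventuallyEq ?_ he
    refine (HasDerivAt.fun_finsetProd fun i (_ : i ∈ Finset.univ) =>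
      hasDerivAt_L (hb i) hs).congr_deriv ?_
    rw [hPP s hs, hZe s hs, Finset.sum_mul, ← Finset.sum_neg_distrib]
    refine Finset.sum_congr rfl fun i _ => ?_
    rw [← Finset.mul_prod_erase _ _ (Finset.mem_univ i), smul_eq_mul]
    ring
  have hh' : (1 : ℝ) ≤ h := by exact_mod_cast hh
  refine not_summable_Gl hh hΦ0 (fun d => ?_) (landau hΦ0 hΦC hZd hZ2 hd (by positivity) ?_)
  · have := hΦ1 d; rwa [hΦe, Complex.ofReal_re] at this
  · rw [div_lt_one (by positivity)]; linarith
end part8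

section part9
lemma not_summable_inv : ¬ Summable fun z : ℤ[i] => ((nn z : ℝ))⁻¹ := by
  intro hs
  let g : (Σ n : ℕ, Fin (n + 1)) → ℤ[i] := fun p => ⟨(p.1 : ℤ) + 1, (p.2 : ℕ)⟩
  have hg : Function.Injective g := by
    rintro ⟨n, j⟩ ⟨m, k⟩ h
    have h1 := congrArg Zsqrtd.re h
    have h2 := congrArg Zsqrtd.im h
    simp only [g] at h1 h2
    have h3 : n = m := by omega
    subst h3
    have h4 : j = k := by ext; omega
    rw [h4]
  have h1 := (hs.comp_injective hg).sigma
  apply Real.not_summable_one_div_natCast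
  rw [← summable_nat_add_iff 1]
  refine Summable.of_nonneg_of_le (fun n => by positivity) (fun n => ?_) (h1.mul_left 2)
  rw [tsum_fintype]
  have h2 : ∀ j : Fin (n + 1), (2 * ((n : ℝ) + 1) ^ 2)⁻¹ ≤
      ((fun z : ℤ[i] => ((nn z : ℝ))⁻¹) ∘ g) ⟨n, j⟩ := by
    intro j
    have hz : g ⟨n, j⟩ ≠ 0 := by
      intro h
      have := congrArg Zsqrtd.re h
      simp only [g, Zsqrtd.re_zero] at this
      omega
    have hpos : (0 : ℝ) < nn (g ⟨n, j⟩) := by exact_mod_cast nn_pos hz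
    simp only [Function.comp]
    gcongr
    have h3 := nn_eq (g ⟨n, j⟩)
    simp only [g] at h3
    have h4 : (nn (g ⟨n, j⟩) : ℝ) = ((n : ℝ) + 1) * (n + 1) + (j : ℕ) * (j : ℕ) := by
      exact_mod_cast h3
    have h5 : ((j : ℕ) : ℝ) ≤ n + 1 := by exact_mod_cast j.2.le
    rw [h4]
    nlinarith [Nat.cast_nonneg (α := ℝ) (j : ℕ)]
  have h3 := Finset.sum_le_sum fun j (_ : j ∈ Finset.univ) => h2 j
  rw [Finset.sum_const, Finset.card_univ, Fintype.card_fin, nsmul_eq_mul] at h3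
  push_cast at h3 ⊢
  refine le_trans (le_of_eq ?_) (mul_le_mul_of_nonneg_left h3 two_pos.le)
  field_simp

lemma summable_powers : Summable fun d : {d : ℤ[i] | ∃ p k, Prime p ∧ p ^ (k + 2) = d} =>
    (nn d : ℝ) ^ (-(3 / 4) : ℝ) := by
  have hB : Summable fun x : ℤ[i] × ℕ => (nn x.1 : ℝ) ^ (-(3 / 2) : ℝ) * ((2 : ℝ) ^ (-(3 / 4) : ℝ)) ^ x.2 :=
    (summable_nn (by norm_num)).mul_of_nonneg
      (summable_geometric_of_lt_one (by positivity)
        (Real.rpow_lt_one_of_one_lt_of_neg (by norm_num) (by norm_num)))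
      (fun _ => by positivity) (fun _ => by positivity)
  choose p k hp hk using fun d : {d : ℤ[i] | ∃ p k, Prime p ∧ p ^ (k + 2) = d} => d.2
  have hinj : Function.Injective fun d => (p d, k d) := by
    intro d e hde
    simp only [Prod.mk.injEq] at hde
    ext1
    rw [← hk d, ← hk e, hde.1, hde.2]
  refine Summable.of_nonneg_of_le (fun d => by positivity) (fun d => ?_) (hB.comp_injective hinj)
  simp only [Function.comp]
  have h2 : (2 : ℝ) ≤ nn (p d) := by exact_mod_cast two_le_nn (hp d)
  have hpos : (0 : ℝ) < nn (p d) := by linarith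
  conv_lhs => rw [← hk d]
  rw [nn_pow, Nat.cast_pow, ← Real.rpow_natCast, ← Real.rpow_mul hpos.le, ← Real.rpow_natCast,
    ← Real.rpow_mul two_pos.le]
  have e : (((k d + 2 : ℕ) : ℝ) * -(3 / 4)) = -(3 / 2) + -(3 / 4) * (k d : ℕ) := by push_cast; ring
  rw [e, Real.rpow_add hpos]
  gcongr ?_ * ?_
  exact Real.rpow_le_rpow_of_nonpos two_pos h2 (by
    have := Nat.cast_nonneg (α := ℝ) (k d); nlinarith)

lemma summable_exceptional (N : ℕ) : Summable
    (Set.indicator {d : ℤ[i] | nn d ≤ N ∨ ∃ p k, Prime p ∧ p ^ (k + 2) = d}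
      fun d => Lam d * (nn d : ℝ)⁻¹) := by
  have hnn : ∀ d, 0 ≤ Lam d * (nn d : ℝ)⁻¹ := fun d => mul_nonneg (Lam_nonneg d) (by positivity)
  have s1 : Summable (Set.indicator {d : ℤ[i] | nn d ≤ N} fun d => Lam d * (nn d : ℝ)⁻¹) := by
    have := (finite_nn_le N).to_subtype
    rw [← summable_subtype_iff_indicator]
    exact Summable.of_finite
  have s2 : Summable (Set.indicator {d : ℤ[i] | ∃ p k, Prime p ∧ p ^ (k + 2) = d}
      fun d => Lam d * (nn d : ℝ)⁻¹) := by
    rw [← summable_subtype_iff_indicator]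
    refine Summable.of_nonneg_of_le (fun d => hnn _) (fun d => ?_) (summable_powers.mul_left 4)
    simp only [Function.comp]
    by_cases hd : (d : ℤ[i]) = 0
    · rw [hd, Lam_zero, zero_mul]; positivity
    have hpos : (0 : ℝ) < nn (d : ℤ[i]) := by exact_mod_cast nn_pos hd
    have h1 : Lam d ≤ (nn (d : ℤ[i]) : ℝ) ^ (1 / 4 : ℝ) / (1 / 4) :=
      (Lam_le d).trans (Real.log_le_rpow_div hpos.le (by norm_num))
    have e : (nn (d : ℤ[i]) : ℝ) ^ (-(3 / 4) : ℝ) =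
        (nn (d : ℤ[i]) : ℝ) ^ (1 / 4 : ℝ) * (nn (d : ℤ[i]) : ℝ)⁻¹ := by
      rw [← Real.rpow_neg_one, ← Real.rpow_add hpos]; norm_num
    rw [e]
    calc _ ≤ (nn (d : ℤ[i]) : ℝ) ^ (1 / 4 : ℝ) / (1 / 4) * (nn (d : ℤ[i]) : ℝ)⁻¹ := by gcongr
      _ = _ := by ring
  refine Summable.of_nonneg_of_le (fun d => Set.indicator_nonneg (fun d _ => hnn d) d) (fun d => ?_) (s1.add s2)
  have n1 := Set.indicator_nonneg (s := {d : ℤ[i] | nn d ≤ N}) (fun d _ => hnn d) d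
  have n2 := Set.indicator_nonneg (s := {d : ℤ[i] | ∃ p k, Prime p ∧ p ^ (k + 2) = d}) (fun d _ => hnn d) d
  by_cases hd : d ∈ {d : ℤ[i] | nn d ≤ N ∨ ∃ p k, Prime p ∧ p ^ (k + 2) = d}
  · rw [Set.indicator_of_mem hd]
    rcases hd with hd | hd
    · rw [Set.indicator_of_mem (s := {d : ℤ[i] | nn d ≤ N}) hd]; linarith
    · rw [Set.indicator_of_mem (s := {d : ℤ[i] | ∃ p k, Prime p ∧ p ^ (k + 2) = d}) hd]; linarith
  · rw [Set.indicator_of_notMem hd]; linarith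

open scoped Topology
open Asymptotics Filter

/-- `Σ Λ(d) N(d)^{-s}` is unbounded as `s → 1+`. -/
lemma P_one_unbounded : ¬ (fun s : ℝ => PP (fun _ => 1) s) =O[𝓝[>] 1] (fun _ => (1 : ℝ)) := by
  intro hO
  rw [isBigO_one_iff, IsBoundedUnder, IsBounded] at hO
  obtain ⟨C, hC⟩ := hO
  rw [eventually_map] at hC
  have hb : ∀ z : ℤ[i], ‖(1 : ℂ)‖ ≤ 1 := by simp
  obtain ⟨K, hK, hexp⟩ := exp_formula (χ := (1 : ℤ[i] →* ℂ)) (C := 1) (by simp) (by simp)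
  have e1 : ((1 : ℤ[i] →* ℂ) : ℤ[i] → ℂ) = fun _ => 1 := rfl
  rw [e1] at hexp
  set M := ‖K‖ * Real.exp (C / Real.log 2) with hM
  have hl2 : 0 < Real.log 2 := Real.log_pos one_lt_two
  have hbound : ∀ᶠ s : ℝ in 𝓝[>] 1, ‖LSeries (fold fun _ => 1) s‖ ≤ M := by
    filter_upwards [hC, self_mem_nhdsWithin] with s hs hs1
    have hs1' : 1 < (s : ℂ).re := by simpa using hs1
    have hs0 : (0 : ℝ) < s := lt_trans one_pos hs1
    rw [hexp s hs1', norm_mul, Complex.norm_exp, hM]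
    gcongr
    have sP := summable_Lam (fun z => hb z) hs1'
    have sF := summable_mul_T (norm_Gl_mul (fun z => hb z)) hs1'
    rw [F_eq hb hs1']
    rw [P_eq hb hs1'] at hs
    have rP : ∀ d : ℤ[i], ((Lam d : ℂ) * 1) * T s d = ((Lam d * (nn d : ℝ) ^ (-s) : ℝ) : ℂ) := by
      intro d; rw [T_real hs0]; push_cast; ring
    have rF : ∀ d : ℤ[i], ((Gl d : ℂ) * 1) * T s d = ((Gl d * (nn d : ℝ) ^ (-s) : ℝ) : ℂ) := by
      intro d; rw [T_real hs0]; push_cast; ring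
    simp only [rP] at sP hs
    simp only [rF] at sF ⊢
    rw [← Complex.ofReal_tsum] at hs ⊢
    rw [Complex.summable_ofReal] at sP sF
    rw [Complex.ofReal_re, le_div_iff₀ hl2, ← tsum_mul_right]
    refine le_trans ?_ ((le_abs_self _).trans (by simpa using hs))
    refine (sF.mul_right _).tsum_le_tsum (fun d => ?_) sP
    have hr : (0 : ℝ) ≤ (nn d : ℝ) ^ (-s) := by positivity
    rw [mul_right_comm]
    refine mul_le_mul_of_nonneg_right ?_ hr
    by_cases hG : Gl d = 0
    · rw [hG, zero_mul]; exact Lam_nonneg d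
    · rw [← log_mul_Gl, mul_comm]
      refine mul_le_mul_of_nonneg_right (Real.log_le_log two_pos ?_) (Gl_nonneg d)
      exact_mod_cast Gl_ne_zero hG
  refine not_summable_inv (summable_of_sum_le (c := M) (fun z => by positivity) fun F => ?_)
  have hlim : Tendsto (fun s : ℝ => ∑ z ∈ F, (nn z : ℝ) ^ (-s)) (𝓝[>] 1)
      (𝓝 (∑ z ∈ F, ((nn z : ℝ))⁻¹)) := by
    refine tendsto_finsetSum _ fun z _ => ?_
    by_cases hz : z = 0
    · rw [hz, nn_zero]
      simp only [Nat.cast_zero, inv_zero]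
      refine tendsto_const_nhds.congr' ?_
      filter_upwards [self_mem_nhdsWithin] with s hs
      have hs' : (1 : ℝ) < s := hs
      rw [Real.zero_rpow (by linarith)]
    · have hpos : (0 : ℝ) < nn z := by exact_mod_cast nn_pos hz
      have hc : ContinuousAt (fun s : ℝ => (nn z : ℝ) ^ (-s)) 1 :=
        (Real.continuousAt_const_rpow hpos.ne').comp continuous_neg.continuousAt
      have := hc.tendsto
      rw [Real.rpow_neg_one] at this
      exact this.mono_left nhdsWithin_le_nhds
  refine le_of_tendsto hlim ?_
  filter_upwards [hbound, self_mem_nhdsWithin] with s hs hs1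
  have hs1' : 1 < (s : ℂ).re := by simpa using hs1
  have hs1'' : (1 : ℝ) < s := hs1
  have hs0 : (0 : ℝ) < s := lt_trans one_pos hs1
  rw [LSeries_fold (by exact_mod_cast hs0.ne') (summable_mul_T (fun z => hb z) hs1')] at hs
  have r : ∀ d : ℤ[i], 1 * T s d = (((nn d : ℝ) ^ (-s) : ℝ) : ℂ) := by
    intro d; rw [T_real hs0, one_mul]
  simp only [r] at hs
  rw [← Complex.ofReal_tsum, Complex.norm_real] at hs
  refine le_trans ?_ ((le_abs_self _).trans hs)
  exact (summable_nn hs1'').sum_le_tsum _ fun z _ => by positivity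
end part9

section part10
open scoped Topology
open Asymptotics Filter

lemma P_bigO {χ : ℤ[i] →* ℂ} (hb : ∀ z, ‖χ z‖ ≤ 1) (hu : ∀ z, IsUnit z → χ z = 1) {L : ℂ → ℂ}
    (hL : DifferentiableOn ℂ L {s | 0 < s.re})
    (hL2 : ∀ s, 1 < s.re → L s = LSeries (fold χ) s) (h1 : L 1 ≠ 0) :
    (fun s : ℝ => PP χ s) =O[𝓝[>] 1] (fun _ => (1 : ℝ)) := by
  have hopen : {s : ℂ | 0 < s.re} ∈ 𝓝 (1 : ℂ) :=
    (isOpen_lt continuous_const Complex.continuous_re).mem_nhds (by simp)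
  have han := hL.analyticAt hopen
  have hc : ContinuousAt (fun s => -(deriv L s / L s)) 1 :=
    (han.deriv.continuousAt.div han.continuousAt h1).neg
  have hc2 : Tendsto (fun s : ℝ => -(deriv L s / L s)) (𝓝[>] 1) (𝓝 (-(deriv L 1 / L 1))) := by
    have : Tendsto (fun s : ℝ => (s : ℂ)) (𝓝[>] 1) (𝓝 1) := by
      have := (Complex.continuous_ofReal.tendsto 1).mono_left (nhdsWithin_le_nhds (s := Set.Ioi 1))
      simpa using this
    exact hc.tendsto.comp this
  refine (hc2.isBigO_one ℝ).congr' ?_ EventuallyEq.rfl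
  filter_upwards [self_mem_nhdsWithin] with s hs
  have hs1 : 1 < (s : ℂ).re := by simpa using hs
  have he : L =ᶠ[𝓝 (s : ℂ)] LSeries (fold χ) := by
    filter_upwards [(isOpen_lt continuous_const Complex.continuous_re).mem_nhds hs1] with t ht
      using hL2 t ht
  rw [he.deriv_eq, he.self_of_nhds, (hasDerivAt_L hb hs1).deriv]
  have := L_ne_zero hb hu hs1
  field_simp

theorem dirichlet {μ : ℤ[i]} (hμ : μ ≠ 0) {α : ℤ[i]} (hα : IsUnit (qm μ α)) :
    {x : ℤ[i] | Prime x ∧ x - α ∈ Ideal.span {μ}}.Infinite := by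
  intro hfin
  obtain ⟨ι, _, _, i0, χ, w, h, hb, hu, h1, hw0, hcont, hh, hΦ, hΦ1, hΨ⟩ := characters hμ hα
  have hcont' : ∀ i, ∃ L : ℂ → ℂ, i ≠ i0 → (DifferentiableOn ℂ L {s | 0 < s.re} ∧
      ∀ s, 1 < s.re → L s = LSeries (fold (χ i)) s) := by
    intro i
    by_cases hi : i = i0
    · exact ⟨0, fun h => absurd hi h⟩
    · obtain ⟨L, hL⟩ := hcont i hi
      exact ⟨L, fun _ => hL⟩
  choose L hL using hcont'
  have hnv := nonvanish hb hu h1 (fun i hi => (hL i hi).1) (fun i hi => (hL i hi).2) hh hΦ hΦ1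
  set Ψ : ℤ[i] → ℂ := fun d => ∑ i, w i * χ i d with hΨdef
  set Cw : ℝ := ∑ i, ‖w i‖ with hCw
  have hΨb : ∀ d, ‖Ψ d‖ ≤ Cw := by
    intro d
    refine (norm_sum_le _ _).trans (Finset.sum_le_sum fun i _ => ?_)
    rw [norm_mul]
    exact mul_le_of_le_one_right (norm_nonneg _) (hb i d)
  have hCw0 : 0 ≤ Cw := (norm_nonneg _).trans (hΨb 0)
  obtain ⟨N0, hN0⟩ := (hfin.image nn).bddAbove
  set N := max N0 (nn μ)
  have hexc : ∀ d, Lam d ≠ 0 → Ψ d ≠ 0 → nn d ≤ N ∨ ∃ p k, Prime p ∧ p ^ (k + 2) = d := by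
    intro d hd hd2
    obtain ⟨p, k, hp, rfl⟩ := Lam_ne_zero hd
    rcases k with _ | k
    · left
      rw [zero_add, pow_one] at hd2 ⊢
      rcases hΨ p hd2 with ⟨u, hu, hu2⟩ | hnu
      · have hpr : Prime (u * p) := (associated_unit_mul_left p u hu).symm.prime hp
        have := hN0 ⟨u * p, ⟨hpr, hu2⟩, rfl⟩
        rw [nn_mul, nn_eq_one.2 hu, one_mul] at this
        exact this.trans (le_max_left _ _)
      · refine le_trans ?_ (le_max_right _ _)
        refine nn_le_of_dvd ?_ hμ
        by_contra hnd
        apply hnu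
        have hcop : IsCoprime p μ := (hp.irreducible.coprime_iff_not_dvd).2 hnd
        obtain ⟨a, b, hab⟩ := hcop
        refine IsUnit.of_mul_eq_one (qm μ a) ?_
        rw [← map_mul, ← map_one (Ideal.Quotient.mk (Ideal.span {μ})), Ideal.Quotient.eq,
          Ideal.mem_span_singleton]
        exact ⟨-b, by rw [← hab]; ring⟩
    · exact Or.inr ⟨p, k, hp, rfl⟩
  have hsum := summable_exceptional N
  have hPΨ : (fun s : ℝ => PP Ψ s) =O[𝓝[>] 1] (fun _ => (1 : ℝ)) := by
    refine IsBigO.of_bound (Cw * ∑' d, (Set.indicator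
      {d : ℤ[i] | nn d ≤ N ∨ ∃ p k, Prime p ∧ p ^ (k + 2) = d}
      fun d => Lam d * (nn d : ℝ)⁻¹) d) ?_
    filter_upwards [self_mem_nhdsWithin] with s hs
    have hs1 : 1 < (s : ℂ).re := by simpa using hs
    have hs1' : (1 : ℝ) < s := hs
    rw [norm_one, mul_one, P_eq hΨb hs1, ← tsum_mul_left]
    refine tsum_of_norm_bounded (hsum.mul_left Cw).hasSum fun d => ?_
    have hnn : 0 ≤ Set.indicator {d : ℤ[i] | nn d ≤ N ∨ ∃ p k, Prime p ∧ p ^ (k + 2) = d}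
        (fun d => Lam d * (nn d : ℝ)⁻¹) d :=
      Set.indicator_nonneg (fun d _ => mul_nonneg (Lam_nonneg d) (by positivity)) d
    by_cases hd : Lam d = 0
    · rw [hd]; simp only [Complex.ofReal_zero, zero_mul, norm_zero]; positivity
    by_cases hd2 : Ψ d = 0
    · rw [hd2]; simp only [mul_zero, zero_mul, norm_zero]; positivity
    rw [Set.indicator_of_mem (s := {d : ℤ[i] | nn d ≤ N ∨ ∃ p k, Prime p ∧ p ^ (k + 2) = d})
      (hexc d hd hd2)]
    rw [norm_mul, norm_mul, norm_T (by linarith), Complex.norm_real,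
      Real.norm_of_nonneg (Lam_nonneg d), Complex.ofReal_re]
    have hd0 : d ≠ 0 := by rintro rfl; exact hd Lam_zero
    have hone : (1 : ℝ) ≤ nn d := by exact_mod_cast nn_pos hd0
    have hr : (nn d : ℝ) ^ (-s) ≤ (nn d : ℝ)⁻¹ := by
      rw [← Real.rpow_neg_one]
      exact Real.rpow_le_rpow_of_exponent_le hone (by linarith)
    have hL0 := Lam_nonneg d
    calc _ ≤ Lam d * Cw * (nn d : ℝ)⁻¹ := by gcongr; exact hΨb d
      _ = _ := by ring
  have hsplit : ∀ s : ℝ, 1 < s → PP Ψ s = ∑ i, w i * PP (χ i) s := by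
    intro s hs
    have hs1 : 1 < (s : ℂ).re := by simpa using hs
    rw [P_eq hΨb hs1, Finset.sum_congr rfl fun i _ => by rw [P_eq (hb i) hs1, ← tsum_mul_left],
      ← Summable.tsum_finsetSum fun i _ => (summable_Lam (hb i) hs1).mul_left (w i)]
    refine tsum_congr fun d => ?_
    simp only [hΨdef]
    rw [Finset.mul_sum, Finset.sum_mul]
    exact Finset.sum_congr rfl fun i _ => by ring
  have e0 : ((χ i0 : ℤ[i] →* ℂ) : ℤ[i] → ℂ) = fun _ => 1 := funext h1
  apply P_one_unbounded
  have hrest : (fun s : ℝ => ∑ i ∈ Finset.univ.erase i0, w i * PP (χ i) s) =O[𝓝[>] 1]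
      (fun _ => (1 : ℝ)) := by
    refine IsBigO.fun_sum fun i hi => ?_
    have hi' := (Finset.mem_erase.1 hi).1
    exact (P_bigO (hb i) (hu i) (hL i hi').1 (hL i hi').2 (hnv i hi')).const_mul_left _
  refine (hPΨ.sub hrest).congr' ?_ EventuallyEq.rfl
  filter_upwards [self_mem_nhdsWithin] with s hs
  rw [hsplit s hs, ← Finset.add_sum_erase _ _ (Finset.mem_univ i0), hw0, one_mul, e0]
  ring

theorem crt_version (J : ℕ) (𝔪 : Fin J → Ideal GaussianInt)
    (α : Fin J → ℤ[i])
    (hne : ∀ j, 𝔪 j ≠ ⊥)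
    (hpair : ∀ j₁ j₂, j₁ ≠ j₂ → 𝔪 j₁ ⊔ 𝔪 j₂ = ⊤)
    (hcop : ∀ j, Ideal.span {α j} ⊔ 𝔪 j = ⊤) :
    {x : ℤ[i] | Prime x ∧ ∀ j, x - α j ∈ 𝔪 j}.Infinite := by
  have hp : Pairwise (Function.onFun IsCoprime 𝔪) := fun i j hij =>
    Ideal.isCoprime_iff_sup_eq.2 (hpair i j hij)
  obtain ⟨a, ha⟩ := Ideal.exists_forall_sub_mem_ideal hp α
  obtain ⟨μ, hμ⟩ := (IsPrincipalIdealRing.principal (⨅ j, 𝔪 j)).principal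
  have hμ' : (⨅ j, 𝔪 j) = Ideal.span {μ} := hμ
  have hprod : (⨅ j, 𝔪 j) = ∏ j, 𝔪 j := by
    have := Ideal.prod_eq_iInf_of_pairwise_isCoprime (s := Finset.univ) (J := 𝔪)
      (fun i _ j _ hij => hp hij)
    simpa using this.symm
  have hμ0 : μ ≠ 0 := by
    rintro rfl
    rw [hprod, Ideal.span_singleton_zero] at hμ'
    obtain ⟨j, _, hj⟩ := Finset.prod_eq_zero_iff.1 hμ'
    exact hne j hj
  have hca : ∀ j, IsCoprime (Ideal.span {a}) (𝔪 j) := by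
    intro j
    rw [Ideal.isCoprime_iff_exists]
    obtain ⟨x, hx, y, hy, hxy⟩ := Ideal.isCoprime_iff_exists.1 (Ideal.isCoprime_iff_sup_eq.2 (hcop j))
    obtain ⟨c, rfl⟩ := Ideal.mem_span_singleton'.1 hx
    refine ⟨c * a, Ideal.mem_span_singleton'.2 ⟨c, rfl⟩, y - c * (a - α j),
      Ideal.sub_mem _ hy (Ideal.mul_mem_left _ _ (ha j)), ?_⟩
    rw [← hxy]; ring
  have hca2 : IsCoprime (Ideal.span {a}) (Ideal.span {μ}) := by
    rw [← hμ', hprod]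
    exact IsCoprime.prod_right fun j _ => hca j
  have hunit : IsUnit (qm μ a) := by
    obtain ⟨x, hx, y, hy, hxy⟩ := Ideal.isCoprime_iff_exists.1 hca2
    obtain ⟨c, rfl⟩ := Ideal.mem_span_singleton'.1 hx
    refine IsUnit.of_mul_eq_one (qm μ c) ?_
    rw [← map_mul, ← map_one (Ideal.Quotient.mk (Ideal.span {μ})), Ideal.Quotient.eq]
    have : a * c - 1 = -y := by rw [← hxy]; ring
    rw [this]; exact Ideal.neg_mem_iff _ |>.2 hy
  refine (dirichlet hμ0 hunit).mono ?_
  rintro x ⟨hx, hxa⟩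
  refine ⟨hx, fun j => ?_⟩
  rw [← hμ', Ideal.mem_iInf] at hxa
  have := Ideal.add_mem _ (hxa j) (ha j)
  simpa using this
end part10
end GD

/-- Dirichlet's theorem for `ℤ[i]`: given pairwise coprime nonzero ideals
`𝔪 j` and elements `α j` coprime to `𝔪 j`, there are infinitely many prime
elements `x` of `ℤ[i]` with `x ≡ α j (mod 𝔪 j)` for all `j`. -/
theorem gaussian_dirichlet (J : ℕ) (𝔪 : Fin J → Ideal GaussianInt)
    (α : Fin J → ℤ[i])
    (hne : ∀ j, 𝔪 j ≠ ⊥)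
    (hpair : ∀ j₁ j₂, j₁ ≠ j₂ → 𝔪 j₁ ⊔ 𝔪 j₂ = ⊤)
    (hcop : ∀ j, Ideal.span {α j} ⊔ 𝔪 j = ⊤) :
    {x : ℤ[i] | Prime x ∧ ∀ j, x - α j ∈ 𝔪 j}.Infinite := by
  exact GD.crt_version J 𝔪 α hne hpair hcop
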